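/- Let G be a bipartite finite simple graph on [n] without isolated vertices and I(G) its edge ideal in S = k[x_1,…,x_n]. Then S/I(G)^{(2)} is generalized Cohen-Macaulay if and only if G is a complete bipartite graph K_{m,m} for some m ≥ 2, or a path of length 3 (a path on 4 vertices), or a disjoint union of edges. -/

import Mathlib

open MvPolynomial CategoryTheory CategoryTheory.Limits

noncomputable section

/-- A simplicial complex on a vertex set `V`: a collection of finite subsets of `V`
closed under taking subsets. -/
def IsSimplicialComplex {V : Type} (Δ : Set (Finset V)) : Prop :=
  ∀ F ∈ Δ, ∀ G : Finset V, G ⊆ F → G ∈ Δ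

/-- The dimension of a simplicial complex: `max {|F| - 1 : F ∈ Δ}`. -/
def complexDim {V : Type} (Δ : Set (Finset V)) : ℤ :=
  sSup ((fun F : Finset V => (F.card : ℤ) - 1) '' Δ)

/-- The star of a face: `st_Δ(F) = {H ∈ Δ : H ∪ F ∈ Δ}`. -/
def complexStar {V : Type} [DecidableEq V] (Δ : Set (Finset V)) (F : Finset V) :
    Set (Finset V) :=
  {H | H ∈ Δ ∧ H ∪ F ∈ Δ}

/-- The facets (maximal faces) of a simplicial complex. -/
def facets {V : Type} (Δ : Set (Finset V)) : Set (Finset V) :=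
  {F | F ∈ Δ ∧ ∀ G ∈ Δ, F ⊆ G → F = G}

/-- The Stanley–Reisner ideal of a simplicial complex `Δ`:
generated by the squarefree monomials `∏_{i ∈ F} x_i` with `F ∉ Δ`. -/
def srIdeal (k : Type) [Field k] {V : Type} (Δ : Set (Finset V)) :
    Ideal (MvPolynomial V k) :=
  Ideal.span {m | ∃ F : Finset V, F ∉ Δ ∧ m = ∏ i ∈ F, X i}

/-- The face prime `P_F = (x_j : j ∉ F)`. -/
def facePrime (k : Type) [Field k] {V : Type} (F : Finset V) :
    Ideal (MvPolynomial V k) :=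
  Ideal.span ((X : V → MvPolynomial V k) '' {j | j ∉ F})

/-- The `m`-th symbolic power of the Stanley–Reisner ideal:
`I_Δ^{(m)} = ⋂_{F facet of Δ} P_F^m`. -/
def symbolicPower (k : Type) [Field k] {V : Type} (Δ : Set (Finset V)) (m : ℕ) :
    Ideal (MvPolynomial V k) :=
  ⨅ F ∈ facets Δ, (facePrime k F) ^ m

/-- The homogeneous maximal ideal `m = (x_1, …, x_n)` of the polynomial ring. -/
def maxIdeal (k : Type) [Field k] (V : Type) : Ideal (MvPolynomial V k) :=
  Ideal.span (Set.range (X : V → MvPolynomial V k))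

/-- The `i`-th local cohomology module `H^i_m(S/I)`. -/
def locCoh (k : Type) [Field k] (V : Type) (I : Ideal (MvPolynomial V k)) (i : ℕ) :
    ModuleCat (MvPolynomial V k) :=
  (localCohomology (maxIdeal k V) i).obj
    (ModuleCat.of (MvPolynomial V k) (MvPolynomial V k ⧸ I))

/-- `S/I` is Cohen–Macaulay: `H^i_m(S/I) = 0` for all `i < dim S/I`. -/
def quotCM (k : Type) [Field k] (V : Type) (I : Ideal (MvPolynomial V k)) : Prop :=
  ∀ i : ℕ, (i : WithBot (WithTop ℕ)) < ringKrullDim (MvPolynomial V k ⧸ I) →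
    Subsingleton (locCoh k V I i)

/-- `S/I` is generalized Cohen–Macaulay: `H^i_m(S/I)` has finite length for all
`i < dim S/I`. -/
def quotGCM (k : Type) [Field k] (V : Type) (I : Ideal (MvPolynomial V k)) : Prop :=
  ∀ i : ℕ, (i : WithBot (WithTop ℕ)) < ringKrullDim (MvPolynomial V k ⧸ I) →
    IsFiniteLength (MvPolynomial V k) (locCoh k V I i)

/-- `S/I` is `r`-Buchsbaum: `m^r · H^i_m(S/I) = 0` for all `i < dim S/I`. -/
def quotKBuchsbaum (k : Type) [Field k] (V : Type) (I : Ideal (MvPolynomial V k))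
    (r : ℕ) : Prop :=
  ∀ i : ℕ, (i : WithBot (WithTop ℕ)) < ringKrullDim (MvPolynomial V k ⧸ I) →
    ∀ x ∈ (maxIdeal k V) ^ r, ∀ y : locCoh k V I i, x • y = 0

/-- The canonical map `Ext^i_S(S/m, S/I) → H^i_m(S/I)`, realized as the colimit
injection at the first power of `m` in the direct system defining local cohomology. -/
def canonicalExtToLocCoh (k : Type) [Field k] (V : Type) (I : Ideal (MvPolynomial V k))
    (i : ℕ) :
    ((localCohomology.diagram (localCohomology.idealPowersDiagram (maxIdeal k V)) i).obj
        (Opposite.op (Opposite.op (1 : ℕ)))).obj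
      (ModuleCat.of (MvPolynomial V k) (MvPolynomial V k ⧸ I)) ⟶ locCoh k V I i :=
  letI := localCohomology.hasColimitDiagram.{0,0}
    (localCohomology.idealPowersDiagram (maxIdeal k V)) i
  (colimit.ι (localCohomology.diagram (localCohomology.idealPowersDiagram (maxIdeal k V)) i)
    (Opposite.op (Opposite.op (1 : ℕ)))).app (ModuleCat.of (MvPolynomial V k) (MvPolynomial V k ⧸ I))

/-- `S/I` is Buchsbaum: the canonical map `Ext^i_S(S/m, S/I) → H^i_m(S/I)` is
surjective for all `i < dim S/I`. -/
def quotBuchsbaum (k : Type) [Field k] (V : Type) (I : Ideal (MvPolynomial V k)) : Prop :=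
  ∀ i : ℕ, (i : WithBot (WithTop ℕ)) < ringKrullDim (MvPolynomial V k ⧸ I) →
    Function.Surjective (canonicalExtToLocCoh k V I i)

/-- A simplicial complex is Cohen–Macaulay if its Stanley–Reisner ring is
Cohen–Macaulay over every field. -/
def complexCM {V : Type} (Δ : Set (Finset V)) : Prop :=
  ∀ (k : Type) [Field k], quotCM k V (srIdeal k Δ)

/-- A simplicial complex is Buchsbaum if its Stanley–Reisner ring is Buchsbaum over
every field. -/
def complexBuchsbaum {V : Type} (Δ : Set (Finset V)) : Prop :=
  ∀ (k : Type) [Field k], quotBuchsbaum k V (srIdeal k Δ)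

/-- The independence complex of a graph: faces are the independent sets. -/
def indepComplex {V : Type} (G : SimpleGraph V) : Set (Finset V) :=
  {F | ∀ i ∈ F, ∀ j ∈ F, ¬ G.Adj i j}

/-- The edge ideal `I(G) = (x_i x_j : ij ∈ E(G))`. -/
def edgeIdeal (k : Type) [Field k] {V : Type} (G : SimpleGraph V) :
    Ideal (MvPolynomial V k) :=
  Ideal.span {m | ∃ i j : V, G.Adj i j ∧ m = X i * X j}

/-- The independence number `α(G)`. -/
def indepNumber {V : Type} (G : SimpleGraph V) : ℕ :=
  sSup {c | ∃ F ∈ indepComplex G, F.card = c}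

/-- A graph is Cohen–Macaulay if its independence complex is. -/
def graphCM {V : Type} (G : SimpleGraph V) : Prop :=
  complexCM (indepComplex G)

/-- The vertex set of the localization `G_{pq} = G \ (N(p) ∪ N(q))` of `G` at an
edge `pq`. -/
def edgeLocSet {V : Type} (G : SimpleGraph V) (p q : V) : Set V :=
  {v | v ∉ G.neighborSet p ∪ G.neighborSet q}

/-- The localization of `G` at an edge `pq`: the induced subgraph on the vertices not
adjacent to `p` or `q` (this removes `p` and `q` as well). -/
def edgeLoc {V : Type} (G : SimpleGraph V) (p q : V) :
    SimpleGraph (edgeLocSet G p q) :=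
  G.induce (edgeLocSet G p q)

/-- `G` is special Cohen–Macaulay: `G` is Cohen–Macaulay and for every edge `pq`,
`G_{pq}` is Cohen–Macaulay with `α(G_{pq}) = α(G) - 1`. -/
def specialCM {V : Type} (G : SimpleGraph V) : Prop :=
  graphCM G ∧ ∀ p q : V, G.Adj p q →
    graphCM (edgeLoc G p q) ∧ indepNumber (edgeLoc G p q) + 1 = indepNumber G

/-- The vertex set of `G_i = G \ ({i} ∪ N(i))`. -/
def vertexLocSet {V : Type} (G : SimpleGraph V) (i : V) : Set V :=
  {v | v ≠ i ∧ v ∉ G.neighborSet i}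

/-- `G_i = G \ ({i} ∪ N(i))`: the induced subgraph obtained by deleting `i` and all
its neighbors. -/
def vertexLoc {V : Type} (G : SimpleGraph V) (i : V) :
    SimpleGraph (vertexLocSet G i) :=
  G.induce (vertexLocSet G i)

/-- A graph is unmixed if all its maximal independent sets have the same cardinality. -/
def graphUnmixed {V : Type} (G : SimpleGraph V) : Prop :=
  ∀ F ∈ facets (indepComplex G), ∀ F' ∈ facets (indepComplex G), F.card = F'.card

/-- `G` has no isolated vertices. -/
def noIsolated {V : Type} (G : SimpleGraph V) : Prop :=
  ∀ v : V, ∃ w : V, G.Adj v w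

end

noncomputable section

section LocalCohomology

open Opposite

namespace ExtComparison

variable {R : Type} [CommRing R] {X X' Y : ModuleCat.{0} R}

/-- The morphism of Hom-complexes induced by a morphism of chain complexes. -/
def linearYonedaMap {K L : ChainComplex (ModuleCat.{0} R) ℕ} (φ : K ⟶ L) (Y : ModuleCat.{0} R) :
    L.linearYonedaObj R Y ⟶ K.linearYonedaObj R Y :=
  (HomologicalComplex.unopFunctor _ _).map
    ((((linearYoneda R (ModuleCat.{0} R)).obj Y).rightOp.mapHomologicalComplex _).map φ).op

lemma homologyOp_inv_unop_naturality {C : Type*} [Category* C] [Abelian C]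
    {K L : CochainComplex C ℕ} (ψ : K ⟶ L) (n : ℕ) :
    (K.homologyOp n).inv.unop ≫ HomologicalComplex.homologyMap ψ n =
      (HomologicalComplex.homologyMap ((HomologicalComplex.opFunctor _ _).map ψ.op) n).unop ≫
      (L.homologyOp n).inv.unop := by
  apply Quiver.Hom.op_inj
  have h2 := HomologicalComplex.homologyOp_hom_naturality ψ n
  exact (Iso.eq_inv_comp _).2
    ((Category.assoc _ _ _).symm.trans ((Iso.comp_inv_eq _).2 h2.symm))

lemma isoExt_naturality {P : ProjectiveResolution X} {P' : ProjectiveResolution X'} {g : X' ⟶ X}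
    (φ : ProjectiveResolution.Hom P' P g) (n : ℕ) :
    ((Ext R (ModuleCat.{0} R) n).map g.op).app Y ≫ (P'.isoExt (R := R) n Y).hom =
      (P.isoExt (R := R) n Y).hom ≫
        HomologicalComplex.homologyMap (linearYonedaMap φ.hom Y) n := by
  have h1 := ProjectiveResolution.isoLeftDerivedObj_inv_naturality g P' P φ.hom
    φ.hom_f_zero_comp_π_f_zero
    ((linearYoneda R (ModuleCat.{0} R)).obj Y).rightOp n
  have h1' := congrArg Quiver.Hom.unop h1
  have h3 := homologyOp_inv_unop_naturality (linearYonedaMap φ.hom Y) n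
  have e1 : (P'.isoExt (R := R) n Y).hom = (P'.isoLeftDerivedObj
      ((linearYoneda R (ModuleCat.{0} R)).obj Y).rightOp n).inv.unop ≫
      (HomologicalComplex.homologyOp (P'.complex.linearYonedaObj R Y) n).inv.unop := rfl
  have e2 : (P.isoExt (R := R) n Y).hom = (P.isoLeftDerivedObj
      ((linearYoneda R (ModuleCat.{0} R)).obj Y).rightOp n).inv.unop ≫
      (HomologicalComplex.homologyOp (P.complex.linearYonedaObj R Y) n).inv.unop := rfl
  rw [e1, e2]
  refine (Category.assoc _ _ _).symm.trans ((congrArg (· ≫ _) h1').trans ?_)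
  refine Eq.trans ?_ (Category.assoc _ _ _).symm
  refine Eq.trans ?_ (congrArg (_ ≫ ·) h3).symm
  exact (Category.assoc _ _ _)


/-- Cocycles for the computation of `Ext` with a projective resolution. -/
def cocycles (P : ProjectiveResolution X) (Y : ModuleCat.{0} R) (n : ℕ) :
    Submodule R (P.complex.X n ⟶ Y) where
  carrier := {f | P.complex.d (n + 1) n ≫ f = 0}
  add_mem' {f g} hf hg := by
    have hf' : P.complex.d (n + 1) n ≫ f = 0 := hf
    have hg' : P.complex.d (n + 1) n ≫ g = 0 := hg
    simp [hf', hg']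
  zero_mem' := by simp
  smul_mem' c f hf := by
    have hf' : P.complex.d (n + 1) n ≫ f = 0 := hf
    simp [hf']

attribute [local instance] hasExt_of_enoughProjectives

open Abelian

/-- Cocycles surject linearly onto `Ext`. -/
def cocyclesToExt (P : ProjectiveResolution X) (Y : ModuleCat.{0} R) (n : ℕ) :
    cocycles P Y n →ₗ[R] Abelian.Ext.{0} X Y n where
  toFun f := P.extMk f.1 (n + 1) rfl f.2
  map_add' f g := (P.add_extMk _ _ _ _ _ _).symm
  map_smul' r f := by
    rw [Abelian.Ext.smul_eq_comp_mk₀]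
    refine Eq.trans ?_ (P.extMk_comp_mk₀ _ _ _ _ _).symm
    simp

lemma cocyclesToExt_surjective (P : ProjectiveResolution X) (Y : ModuleCat.{0} R) (n : ℕ) :
    Function.Surjective (cocyclesToExt P Y n) := fun α ↦ by
  obtain ⟨f, hf, rfl⟩ := P.extMk_surjective α (n + 1) rfl
  exact ⟨⟨f, hf⟩, rfl⟩

lemma exists_toCycles_of_homologyπ_eq_zero (K : CochainComplex (ModuleCat.{0} R) ℕ) (i j : ℕ)
    (hij : (ComplexShape.up ℕ).prev j = i) (x : K.cycles j) (hx : (K.homologyπ j).hom x = 0) :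
    ∃ y : K.X i, (K.toCycles i j).hom y = x := by
  have h := (ShortComplex.exact_of_g_is_cokernel
    (.mk (K.toCycles i j) (K.homologyπ j) (by simp)) (K.homologyIsCokernel i j hij))
  rw [ShortComplex.moduleCat_exact_iff] at h
  exact h x hx

lemma iCycles_injective (K : CochainComplex (ModuleCat.{0} R) ℕ) (j : ℕ) :
    Function.Injective (K.iCycles j).hom :=
  (ModuleCat.mono_iff_injective _).1 inferInstance

/-- Cocycles as cycles of the Hom-complex. -/
def cocyclesToCycles (P : ProjectiveResolution X) (Y : ModuleCat.{0} R) (n : ℕ) :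
    cocycles P Y n →ₗ[R] (P.complex.linearYonedaObj R Y).cycles n :=
    ((P.complex.linearYonedaObj R Y).liftCycles (A := ModuleCat.of R (cocycles P Y n))
      (ModuleCat.ofHom (Submodule.subtype _)) (n + 1) (by simp) (by
        ext f; exact f.2)).hom

lemma iCycles_cocyclesToCycles (P : ProjectiveResolution X) (Y : ModuleCat.{0} R) (n : ℕ)
    (f : cocycles P Y n) :
    ((P.complex.linearYonedaObj R Y).iCycles n).hom (cocyclesToCycles P Y n f) = f.1 := by
  have := (P.complex.linearYonedaObj R Y).liftCycles_i (A := ModuleCat.of R (cocycles P Y n))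
      (ModuleCat.ofHom (Submodule.subtype _)) (n + 1) (by simp) (by
        ext f; exact f.2)
  exact ConcreteCategory.congr_hom this f

/-- Cocycles surject onto the homology of the Hom-complex. -/
def cocyclesToHomology (P : ProjectiveResolution X) (Y : ModuleCat.{0} R) (n : ℕ) :
    cocycles P Y n →ₗ[R] (P.complex.linearYonedaObj R Y).homology n :=
  ((P.complex.linearYonedaObj R Y).homologyπ n).hom ∘ₗ cocyclesToCycles P Y n

lemma cocyclesToHomology_naturality {P : ProjectiveResolution X} {P' : ProjectiveResolution X'}
    {g : X' ⟶ X} (φ : ProjectiveResolution.Hom P' P g) (n : ℕ) (f : cocycles P Y n)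
    (f' : cocycles P' Y n) (h : f'.1 = φ.hom.f n ≫ f.1) :
    (HomologicalComplex.homologyMap (linearYonedaMap φ.hom Y) n).hom
      (cocyclesToHomology P Y n f) = cocyclesToHomology P' Y n f' := by
  have h1 := ConcreteCategory.congr_hom
    (HomologicalComplex.homologyπ_naturality (linearYonedaMap φ.hom Y) n) (cocyclesToCycles P Y n f)
  refine h1.trans ?_
  change ((P'.complex.linearYonedaObj R Y).homologyπ n).hom _ =
    ((P'.complex.linearYonedaObj R Y).homologyπ n).hom _
  congr 1
  apply iCycles_injective
  rw [iCycles_cocyclesToCycles, h]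
  have h2 := ConcreteCategory.congr_hom
    (HomologicalComplex.cyclesMap_i (linearYonedaMap φ.hom Y) n) (cocyclesToCycles P Y n f)
  refine h2.trans ?_
  change ((linearYonedaMap φ.hom Y).f n).hom (((P.complex.linearYonedaObj R Y).iCycles n).hom
    (cocyclesToCycles P Y n f)) = _
  rw [iCycles_cocyclesToCycles]
  rfl

lemma cocyclesToHomology_surjective (P : ProjectiveResolution X) (Y : ModuleCat.{0} R) (n : ℕ) :
    Function.Surjective (cocyclesToHomology P Y n) := by
  intro x
  obtain ⟨z, rfl⟩ := (ModuleCat.epi_iff_surjective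
    ((P.complex.linearYonedaObj R Y).homologyπ n)).1 inferInstance x
  have hz := ConcreteCategory.congr_hom ((P.complex.linearYonedaObj R Y).iCycles_d n (n + 1)) z
  refine ⟨⟨((P.complex.linearYonedaObj R Y).iCycles n).hom z, hz⟩, ?_⟩
  refine congrArg ((P.complex.linearYonedaObj R Y).homologyπ n).hom (iCycles_injective _ _ ?_)
  rw [iCycles_cocyclesToCycles]

lemma cocyclesToHomology_eq_zero_iff (P : ProjectiveResolution X) (Y : ModuleCat.{0} R) (i n : ℕ)
    (hi : (ComplexShape.up ℕ).prev n = i) (f : cocycles P Y n) :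
    cocyclesToHomology P Y n f = 0 ↔ ∃ g : P.complex.X i ⟶ Y, P.complex.d n i ≫ g = f.1 := by
  constructor
  · intro h
    obtain ⟨y, hy⟩ := exists_toCycles_of_homologyπ_eq_zero _ _ _ hi _ h
    refine ⟨y, ?_⟩
    rw [← iCycles_cocyclesToCycles P Y n f, ← hy]
    exact (ConcreteCategory.congr_hom
      ((P.complex.linearYonedaObj R Y).toCycles_i i n) y).symm
  · rintro ⟨g, hg⟩
    have : cocyclesToCycles P Y n f = ((P.complex.linearYonedaObj R Y).toCycles i n).hom g := by
      apply iCycles_injective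
      rw [iCycles_cocyclesToCycles, ← hg]
      exact (ConcreteCategory.congr_hom
        ((P.complex.linearYonedaObj R Y).toCycles_i i n) g).symm
    change ((P.complex.linearYonedaObj R Y).homologyπ n).hom _ = 0
    rw [this]
    exact (ConcreteCategory.congr_hom
      ((P.complex.linearYonedaObj R Y).toCycles_comp_homologyπ i n) g)

lemma eq_zero_of_extMk_eq_zero (P : ProjectiveResolution X) {Y : ModuleCat.{0} R}
    (f : P.complex.X 0 ⟶ Y) (hf : P.complex.d 1 0 ≫ f = 0) (h : P.extMk f 1 rfl hf = 0) :
    f = 0 := by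
  rw [← P.extEquivCohomologyClass.apply_eq_iff_eq,
    P.extEquivCohomologyClass_extMk, P.extEquivCohomologyClass_zero,
    CochainComplex.HomComplex.CohomologyClass.mk_eq_zero_iff,
    CochainComplex.HomComplex.Cocycle.toSingleMk_mem_coboundaries_iff _ _ _ _ _ 1 (by simp)] at h
  obtain ⟨g, hg⟩ := h
  have h0 : IsZero (P.cochainComplex.X 1) := CochainComplex.isZero_of_isStrictlyLE _ 0 _ (by simp)
  rw [h0.eq_zero_of_src g, Limits.comp_zero] at hg
  rw [← cancel_epi (P.cochainComplexXIso (-(0 : ℕ)) 0 rfl).hom, ← hg, Limits.comp_zero]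

lemma ker_eq (P : ProjectiveResolution X) (Y : ModuleCat.{0} R) (n : ℕ) :
    LinearMap.ker (cocyclesToExt P Y n) = LinearMap.ker (cocyclesToHomology P Y n) := by
  ext f
  rw [LinearMap.mem_ker, LinearMap.mem_ker]
  cases n with
  | zero =>
    rw [cocyclesToHomology_eq_zero_iff P Y 0 0 (by simp)]
    have h0 : P.complex.d 0 0 = 0 := P.complex.shape _ _ (by simp)
    simp only [h0, Limits.zero_comp, exists_const]
    constructor
    · intro h
      exact (eq_zero_of_extMk_eq_zero P f.1 f.2 h).symm
    · intro h
      change P.extMk f.1 1 rfl f.2 = 0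
      simp only [← h]
      exact P.extMk_zero 1 rfl
  | succ n =>
    rw [cocyclesToHomology_eq_zero_iff P Y n (n + 1) (by simp)]
    exact P.extMk_eq_zero_iff f.1 _ rfl f.2 _ rfl

/-- `Ext` defined by derived functors is isomorphic to `Ext` defined by derived categories. -/
def extEquiv (X Y : ModuleCat.{0} R) (n : ℕ) :
    ((Ext R (ModuleCat.{0} R) n).obj (op X)).obj Y ≃ₗ[R] Abelian.Ext.{0} X Y n :=
  ((projectiveResolution X).isoExt (R := R) n Y).toLinearEquiv ≪≫ₗ
    ((cocyclesToHomology (projectiveResolution X) Y n).quotKerEquivOfSurjective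
      (cocyclesToHomology_surjective _ _ _)).symm ≪≫ₗ
    Submodule.quotEquivOfEq _ _ (ker_eq _ _ _).symm ≪≫ₗ
    (cocyclesToExt (projectiveResolution X) Y n).quotKerEquivOfSurjective
      (cocyclesToExt_surjective _ _ _)

lemma extEquiv_apply (X Y : ModuleCat.{0} R) (n : ℕ)
    (x : ((Ext R (ModuleCat.{0} R) n).obj (op X)).obj Y)
    (f : cocycles (projectiveResolution X) Y n)
    (h : ((projectiveResolution X).isoExt (R := R) n Y).hom.hom x = cocyclesToHomology _ Y n f) :
    extEquiv X Y n x = cocyclesToExt _ Y n f := by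
  change (cocyclesToExt (projectiveResolution X) Y n).quotKerEquivOfSurjective
      (cocyclesToExt_surjective _ _ _) (Submodule.quotEquivOfEq _ _ (ker_eq _ _ _).symm
        (((cocyclesToHomology (projectiveResolution X) Y n).quotKerEquivOfSurjective
      (cocyclesToHomology_surjective _ _ _)).symm
        (((projectiveResolution X).isoExt (R := R) n Y).hom.hom x))) = _
  rw [h]
  have : ((cocyclesToHomology (projectiveResolution X) Y n).quotKerEquivOfSurjective
      (cocyclesToHomology_surjective _ _ _)).symm (cocyclesToHomology _ Y n f) =
      Submodule.Quotient.mk f := by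
    rw [LinearEquiv.symm_apply_eq]
    rfl
  rw [this]
  rfl

lemma extEquiv_naturality (g : X' ⟶ X) (n : ℕ)
    (x : ((Ext R (ModuleCat.{0} R) n).obj (op X)).obj Y) :
    extEquiv X' Y n ((((Ext R (ModuleCat.{0} R) n).map g.op).app Y).hom x) =
      (Abelian.Ext.mk₀ g).comp (extEquiv X Y n x) (zero_add n) := by
  obtain ⟨f, hf⟩ := cocyclesToHomology_surjective (projectiveResolution X) Y n
    (((projectiveResolution X).isoExt (R := R) n Y).hom.hom x)
  let φ : ProjectiveResolution.Hom (projectiveResolution X') (projectiveResolution X) g :=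
    { hom := ProjectiveResolution.lift g _ _
      hom_f_zero_comp_π_f_zero := by
        rw [← HomologicalComplex.comp_f, ProjectiveResolution.lift_commutes,
          HomologicalComplex.comp_f] }
  let f' : cocycles (projectiveResolution X') Y n := ⟨φ.hom.f n ≫ f.1, by
    have := f.2
    change _ ≫ _ = 0 at this ⊢
    rw [← HomologicalComplex.Hom.comm_assoc, this, Limits.comp_zero]⟩
  rw [extEquiv_apply X Y n x f hf.symm, extEquiv_apply X' Y n _ f']
  · exact (ProjectiveResolution.mk₀_comp_extMk f.1 (n + 1) rfl f.2 φ).symm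
  · refine (ConcreteCategory.congr_hom (isoExt_naturality (Y := Y) φ n) x).trans ?_
    change (HomologicalComplex.homologyMap (linearYonedaMap φ.hom Y) n).hom
      (((projectiveResolution X).isoExt (R := R) n Y).hom.hom x) = _
    rw [← hf]
    exact cocyclesToHomology_naturality φ n f f' rfl

end ExtComparison

open ExtComparison

namespace LimExt

attribute [local instance] hasExt_of_enoughProjectives

variable {R : Type} [CommRing R] (J : Ideal R)

/-- The projection `R/J^t → R/J^s` for `s ≤ t`. -/
def proj {s t : ℕ} (h : s ≤ t) : ModuleCat.of R (R ⧸ J ^ t) ⟶ ModuleCat.of R (R ⧸ J ^ s) :=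
  ModuleCat.ofHom <| Submodule.mapQ _ _ LinearMap.id (Ideal.pow_le_pow_right h)

lemma proj_self (s : ℕ) : proj J (le_refl s) = 𝟙 _ := by
  ext
  rfl

lemma proj_proj {s t u : ℕ} (h : s ≤ t) (h' : t ≤ u) :
    proj J h' ≫ proj J h = proj J (h.trans h') := by
  ext
  rfl

/-- `Ext^i(R/J^t, M)`. -/
abbrev powExt (M : ModuleCat.{0} R) (i t : ℕ) : Type :=
  Abelian.Ext.{0} (ModuleCat.of R (R ⧸ J ^ t)) M i

/-- The transition maps `Ext^i(R/J^s, M) → Ext^i(R/J^t, M)`. -/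
def transition (M : ModuleCat.{0} R) (i s t : ℕ) (h : s ≤ t) :
    powExt J M i s →ₗ[R] powExt J M i t where
  toFun x := (Abelian.Ext.mk₀ (proj J h)).comp x (zero_add i)
  map_add' x y := by simp
  map_smul' r x := by simp

instance (M : ModuleCat.{0} R) (i : ℕ) :
    DirectedSystem (powExt J M i) (fun s t h ↦ transition J M i s t h) where
  map_self s x := by
    change (Abelian.Ext.mk₀ (proj J (le_refl s))).comp x (zero_add i) = x
    rw [proj_self, Abelian.Ext.mk₀_id_comp]
  map_map u t s h h' x := by
    change (Abelian.Ext.mk₀ (proj J h')).comp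
        ((Abelian.Ext.mk₀ (proj J h)).comp x (zero_add i)) (zero_add i) =
      (Abelian.Ext.mk₀ (proj J (h.trans h'))).comp x (zero_add i)
    rw [Abelian.Ext.mk₀_comp_mk₀_assoc, proj_proj]

/-- The direct limit of the modules `Ext^i(R/J^t, M)`. -/
abbrev limExt (M : ModuleCat.{0} R) (i : ℕ) : Type :=
  Module.DirectLimit (powExt J M i) (transition J M i)

/-- The canonical map `Ext^i(R/J^t, M) → limExt J M i`. -/
def of (M : ModuleCat.{0} R) (i t : ℕ) : powExt J M i t →ₗ[R] limExt J M i :=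
  Module.DirectLimit.of R ℕ (powExt J M i) (transition J M i) t

variable {J} in
lemma exists_of {M : ModuleCat.{0} R} {i : ℕ} (x : limExt J M i) : ∃ t y, of J M i t y = x :=
  Module.DirectLimit.exists_of x

lemma of_transition {M : ModuleCat.{0} R} {i s t : ℕ} (h : s ≤ t) (x : powExt J M i s) :
    of J M i t (transition J M i s t h x) = of J M i s x :=
  Module.DirectLimit.of_f

lemma of_eq_zero {M : ModuleCat.{0} R} {i s : ℕ} {x : powExt J M i s} (hx : of J M i s x = 0) :
    ∃ t, ∃ h : s ≤ t, transition J M i s t h x = 0 :=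
  Module.DirectLimit.of.zero_exact hx

/-- The diagram of modules defining local cohomology of `M`. -/
abbrev evalDiagram (M : ModuleCat.{0} R) (i : ℕ) : ℕᵒᵖᵒᵖ ⥤ ModuleCat.{0} R :=
  localCohomology.diagram (localCohomology.idealPowersDiagram J) i ⋙
    (evaluation _ _).obj M

/-- The cocone exhibiting local cohomology of `M` as a colimit. -/
def evalCocone (M : ModuleCat.{0} R) (i : ℕ) : Cocone (evalDiagram J M i) :=
  letI := localCohomology.hasColimitDiagram.{0,0} (localCohomology.idealPowersDiagram J) i
  ((evaluation _ _).obj M).mapCocone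
    (colimit.cocone (localCohomology.diagram (localCohomology.idealPowersDiagram J) i))

def evalIsColimit (M : ModuleCat.{0} R) (i : ℕ) : IsColimit (evalCocone J M i) :=
  letI := localCohomology.hasColimitDiagram.{0,0} (localCohomology.idealPowersDiagram J) i
  isColimitOfPreserves ((evaluation _ _).obj M) (colimit.isColimit _)

/-- The comparison of a term in the diagram. -/
def evalEquiv (M : ModuleCat.{0} R) (i t : ℕ) :
    (evalDiagram J M i).obj (op (op t)) ≃ₗ[R] powExt J M i t :=
  extEquiv (ModuleCat.of R (R ⧸ J ^ t)) M i

lemma evalEquiv_map (M : ModuleCat.{0} R) (i s t : ℕ) (h : s ≤ t)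
    (x : (evalDiagram J M i).obj (op (op s))) :
    evalEquiv J M i t (((evalDiagram J M i).map (homOfLE h).op.op).hom x) =
      transition J M i s t h (evalEquiv J M i s x) :=
  extEquiv_naturality _ _ _

/-- The maps to the colimit. -/
def leg (M : ModuleCat.{0} R) (i t : ℕ) :
    (evalDiagram J M i).obj (op (op t)) →ₗ[R] (localCohomology J i).obj M :=
  ((evalCocone J M i).ι.app (op (op t))).hom

/-- The comparison map. -/
def limToLocal (M : ModuleCat.{0} R) (i : ℕ) :
    limExt J M i →ₗ[R] (localCohomology J i).obj M :=
  Module.DirectLimit.lift R ℕ _ _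
    (fun t ↦ leg J M i t ∘ₗ (evalEquiv J M i t).symm.toLinearMap)
    (fun s t h x ↦ by
      obtain ⟨y, rfl⟩ := (evalEquiv J M i s).surjective x
      rw [← evalEquiv_map]
      refine (congrArg (leg J M i t) ((evalEquiv J M i t).symm_apply_apply _)).trans
        (Eq.trans ?_ (congrArg (leg J M i s) ((evalEquiv J M i s).symm_apply_apply _)).symm)
      exact ConcreteCategory.congr_hom ((evalCocone J M i).w (homOfLE h).op.op) y)

lemma limToLocal_of (M : ModuleCat.{0} R) (i t : ℕ) (x : (evalDiagram J M i).obj (op (op t))) :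
    limToLocal J M i (of J M i t (evalEquiv J M i t x)) =
      leg J M i t x :=
  (Module.DirectLimit.lift_of _ _ _).trans
    (congrArg (leg J M i t) ((evalEquiv J M i t).symm_apply_apply _))

lemma limToLocal_bijective (M : ModuleCat.{0} R) (i : ℕ) :
    Function.Bijective (limToLocal J M i) := by
  constructor
  · rw [injective_iff_map_eq_zero]
    intro x hx
    obtain ⟨t, y, rfl⟩ := exists_of x
    obtain ⟨y, rfl⟩ := (evalEquiv J M i t).surjective y
    rw [limToLocal_of] at hx
    have h0 : leg J M i t y = leg J M i t 0 := by rw [hx, map_zero]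
    obtain ⟨j, f, g, h⟩ := Concrete.isColimit_exists_of_rep_eq _ (evalIsColimit J M i) y 0 h0
    have hf : f = (homOfLE (leOfHom f.unop.unop)).op.op := rfl
    have h' : ((evalDiagram J M i).map f).hom y = 0 := h.trans (map_zero _)
    rw [hf] at h'
    rw [← of_transition J (leOfHom f.unop.unop), ← evalEquiv_map]
    exact (congrArg _ ((congrArg _ h').trans (map_zero _))).trans (map_zero _)
  · intro x
    obtain ⟨j, y, hy⟩ := Concrete.isColimit_exists_rep _ (evalIsColimit J M i) x
    exact ⟨_, (limToLocal_of J M i j.unop.unop y).trans hy⟩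

/-- Local cohomology as a direct limit of `Ext`-modules. -/
def limEquivLocal (M : ModuleCat.{0} R) (i : ℕ) :
    limExt J M i ≃ₗ[R] (localCohomology J i).obj M :=
  LinearEquiv.ofBijective _ (limToLocal_bijective J M i)

end LimExt

namespace LimExt

attribute [local instance] hasExt_of_enoughProjectives

section Postcomp

variable {R : Type} [CommRing R] (J : Ideal R)

lemma transition_comp {M N : ModuleCat.{0} R} {j : ℕ} (α : Abelian.Ext.{0} M N j) {i k : ℕ}
    (h : i + j = k) {s t : ℕ} (hst : s ≤ t) (x : powExt J M i s) :
    Abelian.Ext.comp (transition J M i s t hst x) α h =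
      transition J N k s t hst (Abelian.Ext.comp x α h) :=
  Abelian.Ext.comp_assoc _ _ _ (zero_add i) h (by lia)

/-- Postcomposition with an `Ext`-class on `limExt`. -/
def post {M N : ModuleCat.{0} R} {j : ℕ} (α : Abelian.Ext.{0} M N j) {i k : ℕ} (h : i + j = k) :
    limExt J M i →ₗ[R] limExt J N k :=
  Module.DirectLimit.map
    (fun t ↦
      { toFun := fun x : powExt J M i t ↦ x.comp α h
        map_add' := fun x y ↦ by simp
        map_smul' := fun r x ↦ by simp })
    (fun s t hst ↦ by
      ext x
      exact transition_comp J α h hst x)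

lemma post_of {M N : ModuleCat.{0} R} {j : ℕ} (α : Abelian.Ext.{0} M N j) {i k : ℕ} (h : i + j = k)
    (t : ℕ) (x : powExt J M i t) :
    post J α h (of J M i t x) = of J N k t (x.comp α h) :=
  Module.DirectLimit.map_apply_of _ _ _

variable {A B C : ModuleCat.{0} R} {f : A ⟶ B} {g : B ⟶ C} {w : f ≫ g = 0}
  (hS : (ShortComplex.mk f g w).ShortExact)

include hS in
lemma post_exact₂ (i : ℕ) : Function.Exact (post J (Abelian.Ext.mk₀ f) (add_zero i))
    (post J (Abelian.Ext.mk₀ g) (add_zero i)) := by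
  intro x
  constructor
  · intro hx
    obtain ⟨t, x, rfl⟩ := exists_of x
    rw [post_of] at hx
    obtain ⟨u, htu, hu⟩ := of_eq_zero J hx
    obtain ⟨z, hz⟩ := Abelian.Ext.covariant_sequence_exact₂ _ hS (transition J _ i t u htu x)
      ((transition_comp J _ _ htu x).trans hu)
    refine ⟨of J _ i u z, ?_⟩
    rw [post_of, hz, of_transition]
  · rintro ⟨x, rfl⟩
    obtain ⟨t, x, rfl⟩ := exists_of x
    rw [post_of, post_of]
    simp [w]

lemma post_exact₃ (i : ℕ) : Function.Exact (post J (Abelian.Ext.mk₀ g) (add_zero i))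
    (post J hS.extClass (rfl : i + 1 = i + 1)) := by
  intro x
  constructor
  · intro hx
    obtain ⟨t, x, rfl⟩ := exists_of x
    rw [post_of] at hx
    obtain ⟨u, htu, hu⟩ := of_eq_zero J hx
    obtain ⟨z, hz⟩ := Abelian.Ext.covariant_sequence_exact₃ _ hS (transition J _ i t u htu x)
      rfl ((transition_comp J _ _ htu x).trans hu)
    refine ⟨of J _ i u z, ?_⟩
    rw [post_of, hz, of_transition]
  · rintro ⟨x, rfl⟩
    obtain ⟨t, x, rfl⟩ := exists_of x
    rw [post_of, post_of]
    have h0 : (Abelian.Ext.mk₀ g).comp hS.extClass (zero_add 1) = 0 := hS.comp_extClass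
    rw [Abelian.Ext.comp_assoc_of_second_deg_zero, h0]
    simp

lemma post_exact₁ (i : ℕ) : Function.Exact (post J hS.extClass (rfl : i + 1 = i + 1))
    (post J (Abelian.Ext.mk₀ f) (add_zero (i + 1))) := by
  intro x
  constructor
  · intro hx
    obtain ⟨t, x, rfl⟩ := exists_of x
    rw [post_of] at hx
    obtain ⟨u, htu, hu⟩ := of_eq_zero J hx
    obtain ⟨z, hz⟩ := Abelian.Ext.covariant_sequence_exact₁ _ hS (transition J _ (i + 1) t u htu x)
      ((transition_comp J _ _ htu x).trans hu) rfl
    refine ⟨of J _ i u z, ?_⟩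
    rw [post_of, hz, of_transition]
  · rintro ⟨x, rfl⟩
    obtain ⟨t, x, rfl⟩ := exists_of x
    rw [post_of, post_of]
    have h0 : hS.extClass.comp (Abelian.Ext.mk₀ f) (add_zero 1) = 0 := hS.extClass_comp
    rw [Abelian.Ext.comp_assoc_of_third_deg_zero, h0]
    simp

end Postcomp

end LimExt

open LimExt

variable {R : Type} [CommRing R] (J : Ideal R)

/-- Local cohomology of a module, as the direct limit of `Ext^i(R/J^t, M)`. -/
abbrev HLoc (M : Type) [AddCommGroup M] [Module R M] (i : ℕ) : Type :=
  limExt J (ModuleCat.of R M) i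

namespace HLoc

attribute [local instance] hasExt_of_enoughProjectives

variable {M N P : Type} [AddCommGroup M] [Module R M] [AddCommGroup N] [Module R N]
  [AddCommGroup P] [Module R P]

/-- Functoriality of local cohomology. -/
def map (f : M →ₗ[R] N) (i : ℕ) : HLoc J M i →ₗ[R] HLoc J N i :=
  post J (Abelian.Ext.mk₀ (ModuleCat.ofHom f)) (add_zero i)

lemma map_comp (f : M →ₗ[R] N) (g : N →ₗ[R] P) (i : ℕ) (x : HLoc J M i) :
    map J (g ∘ₗ f) i x = map J g i (map J f i x) := by
  obtain ⟨t, x, rfl⟩ := exists_of x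
  simp only [map, post_of]
  simp

lemma map_smul_id (r : R) (i : ℕ) (x : HLoc J M i) :
    map J (r • LinearMap.id : M →ₗ[R] M) i x = r • x := by
  obtain ⟨t, x, rfl⟩ := exists_of x
  simp only [map, post_of]
  rw [← map_smul, Abelian.Ext.smul_eq_comp_mk₀]
  rfl

lemma map_id (i : ℕ) (x : HLoc J M i) :
    map J (LinearMap.id : M →ₗ[R] M) i x = x := by
  simpa using map_smul_id J (1 : R) i x

lemma map_zero' (i : ℕ) (x : HLoc J M i) :
    map J (0 : M →ₗ[R] N) i x = 0 := by
  obtain ⟨t, x, rfl⟩ := exists_of x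
  simp only [map, post_of]
  have : ModuleCat.ofHom (0 : M →ₗ[R] N) = 0 := rfl
  simp [this]

/-- The long exact sequence of local cohomology. -/
lemma les {f : M →ₗ[R] N} {g : N →ₗ[R] P} (hf : Function.Injective f) (hg : Function.Surjective g)
    (h : Function.Exact f g) :
    ∃ δ : ∀ i, HLoc J P i →ₗ[R] HLoc J M (i + 1), ∀ i,
      Function.Exact (map J f i) (map J g i) ∧ Function.Exact (map J g i) (δ i) ∧
      Function.Exact (δ i) (map J f (i + 1)) := by
  have hS : (ShortComplex.mk (ModuleCat.ofHom f) (ModuleCat.ofHom g)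
      (by ext x; exact h.apply_apply_eq_zero x)).ShortExact :=
    { exact := (ShortComplex.ShortExact.moduleCat_exact_iff_function_exact _).2 h
      mono_f := (ModuleCat.mono_iff_injective _).2 hf
      epi_g := (ModuleCat.epi_iff_surjective _).2 hg }
  refine ⟨fun i ↦ post J hS.extClass (rfl : i + 1 = i + 1), fun i ↦ ⟨?_, ?_, ?_⟩⟩
  · exact post_exact₂ J hS i
  · exact post_exact₃ J hS i
  · exact post_exact₁ J hS i

lemma torsion {i : ℕ} (x : HLoc J M i) : ∃ t : ℕ, ∀ r ∈ J ^ t, r • x = 0 := by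
  obtain ⟨t, x, rfl⟩ := exists_of x
  refine ⟨t, fun r hr ↦ ?_⟩
  rw [← map_smul]
  have h0 : r • 𝟙 (ModuleCat.of R (R ⧸ J ^ t)) = 0 := by
    ext
    exact (Submodule.Quotient.mk_eq_zero _).2 (by simpa using hr)
  have : r • x = (Abelian.Ext.mk₀ (r • 𝟙 (ModuleCat.of R (R ⧸ J ^ t)))).comp x (zero_add i) := by
    rw [Abelian.Ext.mk₀_smul, Abelian.Ext.smul_comp, Abelian.Ext.mk₀_id_comp]
  rw [this, h0]
  simp

/-- The image of `1` for classes of degree zero. -/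
def evPow (M : Type) [AddCommGroup M] [Module R M] (t : ℕ) :
    powExt J (ModuleCat.of R M) 0 t →ₗ[R] M where
  toFun x := (Abelian.Ext.linearEquiv₀ (R := R) x).hom (1 : R ⧸ J ^ t)
  map_add' x y := by simp
  map_smul' r x := by simp

lemma evPow_mk₀ (t : ℕ) (φ : (R ⧸ J ^ t) →ₗ[R] M) :
    evPow J M t (Abelian.Ext.mk₀ (ModuleCat.ofHom φ)) = φ 1 := by
  have : Abelian.Ext.linearEquiv₀ (R := R) (Abelian.Ext.mk₀ (ModuleCat.ofHom φ)) =
      ModuleCat.ofHom φ :=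
    (Abelian.Ext.mk₀_bijective _ _).1 (Abelian.Ext.mk₀_linearEquiv₀_apply _)
  change (Abelian.Ext.linearEquiv₀ (R := R) (Abelian.Ext.mk₀ (ModuleCat.ofHom φ))).hom _ = _
  rw [this]
  rfl

lemma exists_mk₀ (t : ℕ) (x : powExt J (ModuleCat.of R M) 0 t) :
    ∃ φ : (R ⧸ J ^ t) →ₗ[R] M, Abelian.Ext.mk₀ (ModuleCat.ofHom φ) = x :=
  ⟨(Abelian.Ext.linearEquiv₀ (R := R) x).hom, Abelian.Ext.mk₀_linearEquiv₀_apply (R := R) x⟩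

/-- The comparison of degree zero local cohomology with the torsion submodule. -/
def ev (M : Type) [AddCommGroup M] [Module R M] : HLoc J M 0 →ₗ[R] M :=
  Module.DirectLimit.lift R ℕ _ _ (evPow J M) (fun s t h x ↦ by
    obtain ⟨φ, rfl⟩ := exists_mk₀ J s x
    have : transition J (ModuleCat.of R M) 0 s t h (Abelian.Ext.mk₀ (ModuleCat.ofHom φ)) =
        Abelian.Ext.mk₀ (ModuleCat.ofHom
          (φ ∘ₗ Submodule.mapQ _ _ LinearMap.id (Ideal.pow_le_pow_right h))) :=
      Abelian.Ext.mk₀_comp_mk₀ (proj J h) (ModuleCat.ofHom φ)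
    rw [this, evPow_mk₀, evPow_mk₀]
    rfl)

lemma ev_of (t : ℕ) (φ : (R ⧸ J ^ t) →ₗ[R] M) :
    ev J M (of J (ModuleCat.of R M) 0 t (Abelian.Ext.mk₀ (ModuleCat.ofHom φ))) = φ 1 :=
  (Module.DirectLimit.lift_of _ _ _).trans (evPow_mk₀ J t φ)

lemma ev_injective : Function.Injective (ev J M) := by
  rw [injective_iff_map_eq_zero]
  intro x hx
  obtain ⟨t, x, rfl⟩ := exists_of x
  obtain ⟨φ, rfl⟩ := exists_mk₀ J t x
  rw [ev_of] at hx
  have : φ = 0 := by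
    ext
    exact hx
  subst this
  have : ModuleCat.ofHom (0 : (R ⧸ J ^ t) →ₗ[R] M) = 0 := rfl
  simp [this]

lemma exists_ev {m : M} {t : ℕ} (h : ∀ r ∈ J ^ t, r • m = 0) : ∃ x, ev J M x = m := by
  let φ : (R ⧸ J ^ t) →ₗ[R] M := Submodule.liftQ _ (LinearMap.toSpanSingleton R M m) (by
    intro r hr
    exact h r hr)
  refine ⟨_, (ev_of J t φ).trans ?_⟩
  change LinearMap.toSpanSingleton R M m 1 = m
  simp

lemma ev_map (f : M →ₗ[R] N) (x : HLoc J M 0) : ev J N (map J f 0 x) = f (ev J M x) := by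
  obtain ⟨t, x, rfl⟩ := exists_of x
  obtain ⟨φ, rfl⟩ := exists_mk₀ J t x
  rw [ev_of, map, post_of]
  have : (Abelian.Ext.mk₀ (ModuleCat.ofHom φ)).comp
      (Abelian.Ext.mk₀ (ModuleCat.ofHom f)) (add_zero 0) =
      Abelian.Ext.mk₀ (ModuleCat.ofHom (f ∘ₗ φ)) := Abelian.Ext.mk₀_comp_mk₀ _ _
  rw [this, ev_of]
  rfl

lemma subsingleton_of_injective [Module.Injective R M] (i : ℕ) :
    Subsingleton (HLoc J M (i + 1)) := by
  refine subsingleton_of_forall_eq 0 fun x ↦ ?_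
  obtain ⟨t, x, rfl⟩ := exists_of x
  have : CategoryTheory.Injective (ModuleCat.of R M) :=
    Module.injective_object_of_injective_module R M
  rw [Abelian.Ext.eq_zero_of_injective x, map_zero]

end HLoc

/-- The submodule of elements killed by a power of an ideal. -/
def powTorsion {R : Type} [CommRing R] (J : Ideal R) (M : Type) [AddCommGroup M] [Module R M] :
    Submodule R M where
  carrier := {m | ∃ t : ℕ, ∀ r ∈ J ^ t, r • m = 0}
  add_mem' := by
    rintro a b ⟨s, hs⟩ ⟨t, ht⟩
    refine ⟨s + t, fun r hr ↦ ?_⟩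
    rw [smul_add, hs r (Ideal.pow_le_pow_right (Nat.le_add_right s t) hr),
      ht r (Ideal.pow_le_pow_right (Nat.le_add_left t s) hr), add_zero]
  zero_mem' := ⟨0, by simp⟩
  smul_mem' := by
    rintro c a ⟨s, hs⟩
    exact ⟨s, fun r hr ↦ by rw [smul_comm, hs r hr, smul_zero]⟩

section Torsion

variable {R : Type} [CommRing R] (J : Ideal R)
  {M N P : Type} [AddCommGroup M] [Module R M] [AddCommGroup N] [Module R N]
  [AddCommGroup P] [Module R P]

lemma mem_powTorsion {m : M} : m ∈ powTorsion J M ↔ ∃ t : ℕ, ∀ r ∈ J ^ t, r • m = 0 := Iff.rfl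

lemma exists_pow_smul_eq_zero (hM : powTorsion J M = ⊤) (L : Submodule R M) (hL : L.FG) :
    ∃ t : ℕ, ∀ r ∈ J ^ t, ∀ m ∈ L, r • m = 0 := by
  induction L, hL using Submodule.fg_induction with
  | singleton x =>
    obtain ⟨t, ht⟩ := (mem_powTorsion J).1 (hM ▸ Submodule.mem_top : x ∈ powTorsion J M)
    refine ⟨t, fun r hr m hm ↦ ?_⟩
    obtain ⟨c, rfl⟩ := Submodule.mem_span_singleton.1 hm
    rw [smul_comm, ht r hr, smul_zero]
  | sup L₁ L₂ h₁ h₂ ih₁ ih₂ =>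
    obtain ⟨s, hs⟩ := ih₁
    obtain ⟨t, ht⟩ := ih₂
    refine ⟨s + t, fun r hr m hm ↦ ?_⟩
    obtain ⟨a, ha, b, hb, rfl⟩ := Submodule.mem_sup.1 hm
    rw [smul_add, hs r (Ideal.pow_le_pow_right (Nat.le_add_right s t) hr) a ha,
      ht r (Ideal.pow_le_pow_right (Nat.le_add_left t s) hr) b hb, add_zero]

lemma exists_pow_smul_eq_zero_of_isNoetherian [IsNoetherian R M] (hM : powTorsion J M = ⊤) :
    ∃ t : ℕ, ∀ r ∈ J ^ t, ∀ m : M, r • m = 0 := by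
  obtain ⟨t, ht⟩ := exists_pow_smul_eq_zero J hM ⊤ (IsNoetherian.noetherian _)
  exact ⟨t, fun r hr m ↦ ht r hr m Submodule.mem_top⟩

lemma powTorsion_eq_top_of_surjective {g : M →ₗ[R] N} (hg : Function.Surjective g)
    (hM : powTorsion J M = ⊤) : powTorsion J N = ⊤ := by
  refine eq_top_iff.2 fun x _ ↦ ?_
  obtain ⟨m, rfl⟩ := hg x
  obtain ⟨t, ht⟩ := (mem_powTorsion J).1 (hM ▸ Submodule.mem_top : m ∈ powTorsion J M)
  exact ⟨t, fun r hr ↦ by rw [← map_smul, ht r hr, map_zero]⟩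

lemma powTorsion_powTorsion : powTorsion J (powTorsion J M) = ⊤ := by
  refine eq_top_iff.2 fun x _ ↦ ?_
  obtain ⟨t, ht⟩ := x.2
  exact ⟨t, fun r hr ↦ Subtype.ext (ht r hr)⟩

/-- Over a Noetherian ring, the power torsion of an injective module is injective. -/
lemma injective_powTorsion [IsNoetherianRing R] [Module.Injective R M] :
    Module.Injective R (powTorsion J M) := by
  refine Module.Baer.injective fun I g ↦ ?_
  obtain ⟨t, ht⟩ := exists_pow_smul_eq_zero J (powTorsion_powTorsion J) (LinearMap.range g)
    (by
      have : Module.Finite R I := inferInstance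
      exact Submodule.FG.map g this.1 |> (LinearMap.range_eq_map g ▸ ·))
  obtain ⟨k, hk⟩ := Ideal.exists_pow_inf_eq_pow_smul (R := R) (M := R) J I
  have hk' : ∀ r ∈ I, r ∈ J ^ (t + k) → r ∈ J ^ t • I := by
    intro r hr hr'
    have := hk (t + k) (by lia)
    rw [Nat.add_sub_cancel] at this
    have hmem : r ∈ J ^ (t + k) • (⊤ : Ideal R) ⊓ I := ⟨by simpa using hr', hr⟩
    rw [this] at hmem
    exact Submodule.smul_mono le_rfl inf_le_right hmem
  have hg0 : ∀ x : I, (x : R) ∈ J ^ (t + k) → g x = 0 := by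
    intro x hx
    have key : J ^ t • I ≤ Submodule.map I.subtype (LinearMap.ker g) := by
      refine Submodule.smul_le.2 fun a ha b hb ↦ ⟨a • ⟨b, hb⟩, ?_, rfl⟩
      exact (map_smul g a _).trans (ht a ha _ ⟨_, rfl⟩)
    obtain ⟨y, hy, hyx⟩ := key (hk' x x.2 hx)
    rwa [← Subtype.ext hyx]
  let q : I →ₗ[R] R ⧸ J ^ (t + k) := (J ^ (t + k)).mkQ ∘ₗ I.subtype
  have hq : LinearMap.ker q ≤ LinearMap.ker ((powTorsion J M).subtype ∘ₗ g) := by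
    intro x hx
    have : (x : R) ∈ J ^ (t + k) := (Submodule.Quotient.mk_eq_zero _).1 hx
    simp [hg0 x this]
  obtain ⟨h, hh⟩ := Module.Injective.out ((LinearMap.ker q).liftQ q le_rfl)
    (LinearMap.ker_eq_bot.1 (Submodule.ker_liftQ_eq_bot' _ _ rfl))
    ((LinearMap.ker q).liftQ _ hq)
  have h1 : h 1 ∈ powTorsion J M := by
    refine ⟨t + k, fun r hr ↦ ?_⟩
    rw [← map_smul]
    have : r • (1 : R ⧸ J ^ (t + k)) = 0 := by
      refine (Submodule.Quotient.mk_eq_zero _).2 ?_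
      simpa using hr
    rw [this, map_zero]
  refine ⟨LinearMap.toSpanSingleton R _ ⟨h 1, h1⟩, fun x hx ↦ Subtype.ext ?_⟩
  have := hh (Submodule.Quotient.mk ⟨x, hx⟩)
  simp only [Submodule.liftQ_apply] at this
  simp only [LinearMap.toSpanSingleton_apply, Submodule.coe_smul]
  rw [← map_smul]
  refine Eq.trans ?_ this
  congr 1
  change x • Submodule.Quotient.mk 1 = Submodule.Quotient.mk x
  rw [← Submodule.Quotient.mk_smul, smul_eq_mul, mul_one]

end Torsion

lemma isFiniteLength_of_powTorsion_eq_top {R : Type} [CommRing R] [IsNoetherianRing R] (J : Ideal R)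
    [J.IsMaximal] {M : Type*} [AddCommGroup M] [Module R M] [IsNoetherian R M]
    {t : ℕ} (hM : ∀ r ∈ J ^ t, ∀ m : M, r • m = 0) : IsFiniteLength R M := by
  rw [isFiniteLength_iff_isNoetherian_isArtinian]
  refine ⟨inferInstance, ?_⟩
  have htor : Module.IsTorsionBySet R M (J ^ t : Ideal R) := fun m r ↦ hM r r.2 m
  let := htor.module
  have : IsScalarTower R (R ⧸ J ^ t) M := htor.isScalarTower
  have : Ring.KrullDimLE 0 (R ⧸ J ^ t) := by
    rw [Ring.krullDimLE_zero_iff]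
    intro p hp
    have hp' := Ideal.comap_isPrime (Ideal.Quotient.mk (J ^ t)) p
    have h1 : J ≤ p.comap (Ideal.Quotient.mk (J ^ t)) := by
      refine Ideal.IsPrime.le_of_pow_le (n := t) fun x hx ↦ ?_
      rw [Ideal.mem_comap, Ideal.Quotient.eq_zero_iff_mem.2 hx]
      exact p.zero_mem
    have h2 := (‹J.IsMaximal›.eq_of_le hp'.ne_top h1)
    have : (p.comap (Ideal.Quotient.mk (J ^ t))).IsMaximal := h2 ▸ ‹J.IsMaximal›
    have hmap := Ideal.map_comap_of_surjective _ (Ideal.Quotient.mk_surjective (I := J ^ t)) p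
    have := Ideal.map_eq_top_or_isMaximal_of_surjective _
      (Ideal.Quotient.mk_surjective (I := J ^ t)) this
    rw [hmap] at this
    exact this.resolve_left hp.ne_top
  have := IsNoetherianRing.isArtinianRing_of_krullDimLE_zero (R := R ⧸ J ^ t)
  have : Module.Finite (R ⧸ J ^ t) M := Module.Finite.of_restrictScalars_finite R _ _
  have : IsArtinian (R ⧸ J ^ t) M := isArtinian_of_fg_of_artinian'
  exact isArtinian_of_surjective_algebraMap (S := R) (R := R ⧸ J ^ t) Ideal.Quotient.mk_surjective

namespace HLoc

variable {R : Type} [CommRing R] (J : Ideal R)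
  {M N P : Type} [AddCommGroup M] [Module R M] [AddCommGroup N] [Module R N]
  [AddCommGroup P] [Module R P]

lemma powTorsion_eq_top (i : ℕ) : powTorsion J (HLoc J M i) = ⊤ :=
  eq_top_iff.2 fun x _ ↦ torsion J x

lemma map_injective {f : M →ₗ[R] N} (hf : Function.Injective f) :
    Function.Injective (map J f 0) := by
  intro x y hxy
  refine ev_injective J (hf ?_)
  rw [← ev_map, ← ev_map, hxy]

lemma map_surjective {f : M →ₗ[R] N} (hf : Function.Surjective f) (hM : powTorsion J M = ⊤) :
    Function.Surjective (map J f 0) := by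
  intro y
  obtain ⟨m, hm⟩ := hf (ev J N y)
  obtain ⟨t, ht⟩ := (mem_powTorsion J).1 (hM ▸ Submodule.mem_top : m ∈ powTorsion J M)
  obtain ⟨x, rfl⟩ := exists_ev J ht
  refine ⟨x, ev_injective J ?_⟩
  rw [ev_map, hm]

instance [IsNoetherian R M] : IsNoetherian R (HLoc J M 0) :=
  isNoetherian_of_injective (ev J M) (ev_injective J)

lemma subsingleton_succ_of_powTorsion [IsNoetherianRing R] (hM : powTorsion J M = ⊤) (i : ℕ) :
    Subsingleton (HLoc J M (i + 1)) := by
  induction i using Nat.strong_induction_on generalizing M with | _ i ih => ?_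
  have := ModuleCat.enoughInjectives.{0} R
  let E := CategoryTheory.Injective.under (ModuleCat.of R M)
  have hE : Module.Injective R E := Module.injective_module_of_injective_object R E
    (inj := inferInstanceAs (CategoryTheory.Injective E))
  have hE' := injective_powTorsion (M := E) J
  let ι₀ : M →ₗ[R] E := (CategoryTheory.Injective.ι (ModuleCat.of R M)).hom
  have hι₀ : Function.Injective ι₀ :=
    (ModuleCat.mono_iff_injective (CategoryTheory.Injective.ι (ModuleCat.of R M))).1 inferInstance
  let ι : M →ₗ[R] powTorsion J E := ι₀.codRestrict _ fun m ↦ by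
    obtain ⟨t, ht⟩ := (mem_powTorsion J).1 (hM ▸ Submodule.mem_top : m ∈ powTorsion J M)
    exact ⟨t, fun r hr ↦ by rw [← map_smul, ht r hr, map_zero]⟩
  have hι : Function.Injective ι := fun x y hxy ↦ hι₀ (congrArg Subtype.val hxy)
  have hsurj := Submodule.mkQ_surjective (LinearMap.range ι)
  obtain ⟨δ, hδ⟩ := les J hι hsurj (LinearMap.exact_map_mkQ_range ι)
  have hvan := subsingleton_of_injective J (M := powTorsion J E) i
  refine subsingleton_of_forall_eq 0 fun y ↦ ?_
  obtain ⟨z, rfl⟩ := ((hδ i).2.2 y).1 (Subsingleton.elim _ _)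
  cases i with
  | zero =>
    obtain ⟨u, rfl⟩ := map_surjective J hsurj (powTorsion_powTorsion J) z
    exact (hδ 0).2.1.apply_apply_eq_zero u
  | succ i =>
    have := ih i (by lia) (powTorsion_eq_top_of_surjective J hsurj (powTorsion_powTorsion J))
    rw [Subsingleton.elim z 0, map_zero]

/-- Local cohomology vanishes below degree `d`. -/
def Vanish (M : Type) [AddCommGroup M] [Module R M] (d : ℕ) : Prop :=
  ∀ i < d, Subsingleton (HLoc J M i)

/-- Local cohomology is Noetherian below degree `d`. -/
def Finitary (M : Type) [AddCommGroup M] [Module R M] (d : ℕ) : Prop :=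
  ∀ i < d, IsNoetherian R (HLoc J M i)

variable {J}

lemma Vanish.finitary {d : ℕ} (h : Vanish J M d) : Finitary J M d := fun i hi ↦
  have := h i hi
  inferInstance

lemma Vanish.mono {d e : ℕ} (h : Vanish J M d) (hed : e ≤ d) : Vanish J M e := fun i hi ↦
  h i (hi.trans_le hed)

lemma Vanish.of_subsingleton [Subsingleton M] (d : ℕ) : Vanish J M d := fun i _ ↦
  subsingleton_of_forall_eq 0 fun x ↦ by
    rw [← map_id J i x, Subsingleton.elim (LinearMap.id : M →ₗ[R] M) 0, map_zero']

section Exact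

variable {f : M →ₗ[R] N} {g : N →ₗ[R] P} (hf : Function.Injective f) (hg : Function.Surjective g)
  (h : Function.Exact f g)

include hf hg h

lemma Vanish.of_exact {d : ℕ} (hM : Vanish J M d) (hP : Vanish J P d) : Vanish J N d := by
  obtain ⟨δ, hδ⟩ := les J hf hg h
  intro i hi
  have := hM i hi
  have := hP i hi
  refine subsingleton_of_forall_eq 0 fun x ↦ ?_
  obtain ⟨y, rfl⟩ := ((hδ i).1 x).1 (Subsingleton.elim _ _)
  rw [Subsingleton.elim y 0, map_zero]

lemma Finitary.of_exact {d : ℕ} (hM : Finitary J M d) (hP : Finitary J P d) :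
    Finitary J N d := by
  obtain ⟨δ, hδ⟩ := les J hf hg h
  intro i hi
  have := hM i hi
  have := hP i hi
  exact isNoetherian_of_range_eq_ker _ _ (LinearMap.exact_iff.1 (hδ i).1).symm

lemma Finitary.of_exact_of_powTorsion [IsNoetherianRing R] [IsNoetherian R P] {d : ℕ}
    (hN : Finitary J N d) (hP : powTorsion J P = ⊤) : Finitary J M d := by
  obtain ⟨δ, hδ⟩ := les J hf hg h
  intro i hi
  have := hN i hi
  cases i with
  | zero => exact isNoetherian_of_injective _ (map_injective J hf)
  | succ i =>
    have : IsNoetherian R (HLoc J P i) := by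
      cases i with
      | zero => infer_instance
      | succ i =>
        have := subsingleton_succ_of_powTorsion J hP i
        infer_instance
    exact isNoetherian_of_range_eq_ker _ _ (LinearMap.exact_iff.1 (hδ i).2.2).symm

end Exact

lemma Vanish.of_regular {x : R} (hx : x ∈ J) {f : M →ₗ[R] M} (hfx : ∀ m, f m = x • m)
    {g : M →ₗ[R] P} (hf : Function.Injective f) (hg : Function.Surjective g)
    (h : Function.Exact f g) {d : ℕ} (hP : Vanish J P d) : Vanish J M (d + 1) := by
  obtain ⟨δ, hδ⟩ := les J hf hg h
  have hfx' : f = x • LinearMap.id := by ext m; simp [hfx]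
  intro i hi
  have hinj : ∀ y : HLoc J M i, x • y = 0 → y = 0 := by
    intro y hy
    rw [← map_smul_id, ← hfx'] at hy
    cases i with
    | zero => exact map_injective J hf (hy.trans (map_zero _).symm)
    | succ i =>
      have := hP i (by lia)
      obtain ⟨z, rfl⟩ := ((hδ i).2.2 y).1 hy
      rw [Subsingleton.elim z 0, map_zero]
  refine subsingleton_of_forall_eq 0 fun y ↦ ?_
  obtain ⟨t, ht⟩ := torsion J y
  have hpow : ∀ s : ℕ, x ^ s • y = 0 → y = 0 := by
    intro s
    induction s with
    | zero => simp
    | succ s ih =>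
      intro hs
      rw [pow_succ', mul_smul] at hs
      exact ih (hinj _ hs)
  exact hpow t (ht _ (Ideal.pow_mem_pow hx t))

/-- `z` kills the local cohomology in degrees below `d`. -/
def Kills (z : R) (M : Type) [AddCommGroup M] [Module R M] (J : Ideal R) (d : ℕ) : Prop :=
  ∀ i < d, ∀ y : HLoc J M i, z • y = 0

lemma Kills.of_exact {z : R} {f : M →ₗ[R] M}
    {g : M →ₗ[R] P} (hf : Function.Injective f) (hg : Function.Surjective g)
    (h : Function.Exact f g) {d : ℕ} (hM : Kills z M J (d + 1)) : Kills (z * z) P J d := by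
  obtain ⟨δ, hδ⟩ := les J hf hg h
  intro i hi y
  have h1 : δ i (z • y) = 0 := by rw [map_smul, hM (i + 1) (by lia)]
  obtain ⟨u, hu⟩ := ((hδ i).2.1 _).1 h1
  rw [mul_smul, ← hu, ← map_smul, hM i (by lia), map_zero]

lemma Kills.of_factor {z : R} {f : M →ₗ[R] N} {g : N →ₗ[R] M} (hfg : ∀ m, g (f m) = z • m)
    {w : R} {d : ℕ} (hN : Kills w N J d) : Kills (w * z) M J d := by
  intro i hi y
  have : g ∘ₗ f = z • LinearMap.id := by ext m; simp [hfg]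
  rw [mul_smul, ← map_smul_id J z, ← this, map_comp, ← map_smul, hN i hi, map_zero]

lemma Kills.smul_eq_zero {z : R} {d : ℕ} (hM : Kills z M J (d + 1)) {m : M}
    (hm : m ∈ powTorsion J M) : z • m = 0 := by
  obtain ⟨t, ht⟩ := hm
  obtain ⟨x, rfl⟩ := exists_ev J ht
  rw [← map_smul, hM 0 (by lia), map_zero]

lemma Finitary.exists_kills {d : ℕ} (hM : Finitary J M d) {x : R} (hx : x ∈ J) :
    ∃ t : ℕ, Kills (x ^ t) M J d := by
  have key : ∀ i < d, ∃ t : ℕ, ∀ r ∈ J ^ t, ∀ y : HLoc J M i, r • y = 0 := fun i hi ↦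
    have := hM i hi
    exists_pow_smul_eq_zero_of_isNoetherian J (powTorsion_eq_top J i)
  choose! t ht using key
  refine ⟨∑ i ∈ Finset.range d, t i, fun i hi y ↦ ht i hi _ ?_ y⟩
  exact Ideal.pow_le_pow_right (Finset.single_le_sum (f := t) (fun _ _ ↦ Nat.zero_le _)
    (Finset.mem_range.2 hi)) (Ideal.pow_mem_pow hx _)

lemma isFiniteLength [IsNoetherianRing R] [J.IsMaximal] (i : ℕ) [IsNoetherian R (HLoc J M i)] :
    IsFiniteLength R (HLoc J M i) :=
  have ⟨_, ht⟩ := exists_pow_smul_eq_zero_of_isNoetherian J (powTorsion_eq_top J (M := M) i)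
  isFiniteLength_of_powTorsion_eq_top J ht

end HLoc

section QuotientSequences

variable {R : Type} [CommRing R] {I K L : Ideal R} {f : R}

/-- The sequence `0 → R/(I : f) → R/I → R/(I + f) → 0`. -/
lemma exists_colon_sequence (hK : ∀ g, g ∈ K ↔ f * g ∈ I) (hL : ∀ g, g ∈ L ↔ ∃ a, g - f * a ∈ I) :
    ∃ (φ : (R ⧸ K) →ₗ[R] R ⧸ I) (ψ : (R ⧸ I) →ₗ[R] R ⧸ L),
      (∀ g : R, φ (Ideal.Quotient.mk K g) = Ideal.Quotient.mk I (f * g)) ∧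
      Function.Injective φ ∧ Function.Surjective ψ ∧ Function.Exact φ ψ := by
  have hIL : I ≤ L := fun g hg ↦ (hL g).2 ⟨0, by simpa using hg⟩
  have hKI : K ≤ LinearMap.ker (I.mkQ ∘ₗ LinearMap.mulLeft R f) := fun g hg ↦
    (Submodule.Quotient.mk_eq_zero _).2 ((hK g).1 hg)
  refine ⟨Submodule.liftQ K _ hKI, Submodule.mapQ I L LinearMap.id hIL, fun g ↦ rfl, ?_, ?_, ?_⟩
  · rw [injective_iff_map_eq_zero]
    intro x hx
    obtain ⟨g, rfl⟩ := Submodule.Quotient.mk_surjective _ x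
    exact (Submodule.Quotient.mk_eq_zero _).2 ((hK g).2 ((Submodule.Quotient.mk_eq_zero _).1 hx))
  · intro x
    obtain ⟨g, rfl⟩ := Submodule.Quotient.mk_surjective _ x
    exact ⟨Submodule.Quotient.mk g, rfl⟩
  · intro x
    obtain ⟨g, rfl⟩ := Submodule.Quotient.mk_surjective _ x
    constructor
    · intro hg
      obtain ⟨a, ha⟩ := (hL g).1 ((Submodule.Quotient.mk_eq_zero _).1 hg)
      exact ⟨Submodule.Quotient.mk a, ((Submodule.Quotient.eq _).2 ha).symm⟩
    · rintro ⟨y, hy⟩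
      obtain ⟨a, rfl⟩ := Submodule.Quotient.mk_surjective _ y
      refine (Submodule.Quotient.mk_eq_zero _).2 ((hL g).2 ⟨a, ?_⟩)
      exact (Submodule.Quotient.eq _).1 hy.symm

lemma powTorsion_quotient_eq_top {J : Ideal R} {t : ℕ} (h : J ^ t ≤ I) :
    powTorsion J (R ⧸ I) = ⊤ := by
  refine eq_top_iff.2 fun x _ ↦ ?_
  obtain ⟨g, rfl⟩ := Submodule.Quotient.mk_surjective _ x
  refine ⟨t, fun r hr ↦ ?_⟩
  rw [← Submodule.Quotient.mk_smul]
  exact (Submodule.Quotient.mk_eq_zero _).2 (I.mul_mem_right _ (h hr))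

variable {J : Ideal R}

namespace HLoc

lemma Vanish.of_colon (hK : ∀ g, g ∈ K ↔ f * g ∈ I) (hL : ∀ g, g ∈ L ↔ ∃ a, g - f * a ∈ I) {d : ℕ}
    (h₁ : Vanish J (R ⧸ K) d) (h₂ : Vanish J (R ⧸ L) d) : Vanish J (R ⧸ I) d := by
  obtain ⟨φ, ψ, -, hφ, hψ, h⟩ := exists_colon_sequence hK hL
  exact Vanish.of_exact hφ hψ h h₁ h₂

lemma Finitary.of_colon (hK : ∀ g, g ∈ K ↔ f * g ∈ I) (hL : ∀ g, g ∈ L ↔ ∃ a, g - f * a ∈ I)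
    {d : ℕ} (h₁ : Finitary J (R ⧸ K) d) (h₂ : Finitary J (R ⧸ L) d) : Finitary J (R ⧸ I) d := by
  obtain ⟨φ, ψ, -, hφ, hψ, h⟩ := exists_colon_sequence hK hL
  exact Finitary.of_exact hφ hψ h h₁ h₂

lemma exists_regular_sequence (hf : ∀ g, f * g ∈ I → g ∈ I)
    (hL : ∀ g, g ∈ L ↔ ∃ a, g - f * a ∈ I) :
    ∃ (φ : (R ⧸ I) →ₗ[R] R ⧸ I) (ψ : (R ⧸ I) →ₗ[R] R ⧸ L),
      (∀ m, φ m = f • m) ∧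
      Function.Injective φ ∧ Function.Surjective ψ ∧ Function.Exact φ ψ := by
  obtain ⟨φ, ψ, hφ, h⟩ := exists_colon_sequence (K := I)
    (fun g ↦ ⟨fun hg ↦ I.mul_mem_left _ hg, hf g⟩) hL
  refine ⟨φ, ψ, fun m ↦ ?_, h⟩
  obtain ⟨g, rfl⟩ := Submodule.Quotient.mk_surjective _ m
  exact hφ g

lemma Vanish.of_quotient_regular (hfJ : f ∈ J) (hf : ∀ g, f * g ∈ I → g ∈ I)
    (hL : ∀ g, g ∈ L ↔ ∃ a, g - f * a ∈ I) {d : ℕ} (h : Vanish J (R ⧸ L) d) :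
    Vanish J (R ⧸ I) (d + 1) := by
  obtain ⟨φ, ψ, hφ, h₁, h₂, h₃⟩ := exists_regular_sequence hf hL
  exact Vanish.of_regular hfJ hφ h₁ h₂ h₃ h

lemma Kills.of_quotient_regular (hf : ∀ g, f * g ∈ I → g ∈ I)
    (hL : ∀ g, g ∈ L ↔ ∃ a, g - f * a ∈ I) {z : R} {d : ℕ} (h : Kills z (R ⧸ I) J (d + 1)) :
    Kills (z * z) (R ⧸ L) J d := by
  obtain ⟨φ, ψ, hφ, h₁, h₂, h₃⟩ := exists_regular_sequence hf hL
  exact Kills.of_exact h₁ h₂ h₃ h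

lemma Kills.mul_mem {z : R} {d : ℕ} (h : Kills z (R ⧸ I) J (d + 1)) {g : R} {t : ℕ}
    (hg : ∀ r ∈ J ^ t, r * g ∈ I) : z * g ∈ I := by
  have := h.smul_eq_zero (m := Ideal.Quotient.mk I g)
    ⟨t, fun r hr ↦ (Submodule.Quotient.mk_eq_zero _).2 (hg r hr)⟩
  exact (Submodule.Quotient.mk_eq_zero _).1 this

/-- If `z` multiplies `K` into `I ⊆ K`, the map `z` on `R/K` factors through `R/I`. -/
lemma Kills.of_le (hIK : I ≤ K) {z : R} (hz : ∀ g ∈ K, z * g ∈ I) {w : R} {d : ℕ}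
    (h : Kills w (R ⧸ I) J d) : Kills (w * z) (R ⧸ K) J d := by
  have hKI : K ≤ LinearMap.ker (I.mkQ ∘ₗ LinearMap.mulLeft R z) := fun g hg ↦
    (Submodule.Quotient.mk_eq_zero _).2 (hz g hg)
  refine Kills.of_factor (f := Submodule.liftQ K _ hKI) (g := Submodule.mapQ I K LinearMap.id hIK)
    (fun m ↦ ?_) h
  obtain ⟨g, rfl⟩ := Submodule.Quotient.mk_surjective _ m
  rfl

/-- The sequence `0 → R/(K ∩ L) → R/K × R/L → R/(K + L) → 0` with torsion last term. -/
lemma Finitary.of_inf [IsNoetherianRing R] (hI : I = K ⊓ L) {t d : ℕ} (ht : J ^ t ≤ K ⊔ L)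
    (hK : Finitary J (R ⧸ K) d) (hL : Finitary J (R ⧸ L) d) : Finitary J (R ⧸ I) d := by
  have hprod : Finitary J ((R ⧸ K) × (R ⧸ L)) d := Finitary.of_exact
    (f := LinearMap.inl R (R ⧸ K) (R ⧸ L)) (g := LinearMap.snd R (R ⧸ K) (R ⧸ L))
    LinearMap.inl_injective LinearMap.snd_surjective Function.Exact.inl_snd hK hL
  have hIK : I ≤ K := hI ▸ inf_le_left
  have hIL : I ≤ L := hI ▸ inf_le_right
  refine Finitary.of_exact_of_powTorsion (P := R ⧸ (K ⊔ L))
    (f := (Submodule.mapQ I K LinearMap.id hIK).prod (Submodule.mapQ I L LinearMap.id hIL))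
    (g := (Submodule.mapQ K (K ⊔ L) LinearMap.id le_sup_left).coprod
      (-(Submodule.mapQ L (K ⊔ L) LinearMap.id le_sup_right))) ?_ ?_ ?_ hprod
    (powTorsion_quotient_eq_top ht)
  · rw [injective_iff_map_eq_zero]
    intro x hx
    obtain ⟨g, rfl⟩ := Submodule.Quotient.mk_surjective _ x
    refine (Submodule.Quotient.mk_eq_zero _).2 (hI ▸ ⟨?_, ?_⟩)
    · exact (Submodule.Quotient.mk_eq_zero _).1 (congrArg Prod.fst hx)
    · exact (Submodule.Quotient.mk_eq_zero _).1 (congrArg Prod.snd hx)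
  · intro x
    obtain ⟨g, rfl⟩ := Submodule.Quotient.mk_surjective _ x
    exact ⟨(Submodule.Quotient.mk g, 0), by simp⟩
  · rintro ⟨x, y⟩
    obtain ⟨a, rfl⟩ := Submodule.Quotient.mk_surjective _ x
    obtain ⟨b, rfl⟩ := Submodule.Quotient.mk_surjective _ y
    constructor
    · intro hx
      have hx' : a - b ∈ K ⊔ L := by
        refine (Submodule.Quotient.mk_eq_zero _).1 (Eq.trans ?_ hx)
        simp [sub_eq_add_neg]
      obtain ⟨u, hu, v, hv, huv⟩ := Submodule.mem_sup.1 hx'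
      refine ⟨Submodule.Quotient.mk (b + v), Prod.ext ((Submodule.Quotient.eq _).2 ?_)
        ((Submodule.Quotient.eq _).2 ?_)⟩
      · have : b + v - a = -u := by linear_combination huv
        simpa [this] using hu
      · simpa using hv
    · rintro ⟨z, hz⟩
      obtain ⟨g, rfl⟩ := Submodule.Quotient.mk_surjective _ z
      rw [← hz]
      simp

end HLoc

end QuotientSequences

end LocalCohomology

section MonomialIdeal

variable (k : Type) [Field k] {V : Type}

/-- The ideal of polynomials all of whose exponents lie in an upper set. -/
def monIdeal (U : UpperSet (V →₀ ℕ)) : Ideal (MvPolynomial V k) where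
  carrier := {g | ∀ e ∉ U, coeff e g = 0}
  add_mem' ha hb e he := by rw [coeff_add, ha e he, hb e he, add_zero]
  zero_mem' e _ := coeff_zero e
  smul_mem' c g hg e he := by
    classical
    rw [smul_eq_mul, coeff_mul]
    refine Finset.sum_eq_zero fun x hx ↦ ?_
    rw [hg x.2 fun h ↦ he (U.upper ?_ h), mul_zero]
    rw [← Finset.HasAntidiagonal.mem_antidiagonal.1 hx]
    exact le_add_self

variable {k}

lemma mem_monIdeal {U : UpperSet (V →₀ ℕ)} {g : MvPolynomial V k} :
    g ∈ monIdeal k U ↔ ∀ e ∉ U, coeff e g = 0 := Iff.rfl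

lemma monomial_mem_monIdeal {U : UpperSet (V →₀ ℕ)} {e : V →₀ ℕ} :
    monomial e (1 : k) ∈ monIdeal k U ↔ e ∈ U := by
  classical
  rw [mem_monIdeal]
  constructor
  · intro h
    by_contra he
    simpa using h e he
  · intro he e' he'
    rw [coeff_monomial, if_neg]
    rintro rfl
    exact he' he

lemma monIdeal_mono {U W : UpperSet (V →₀ ℕ)} (h : ∀ e ∈ U, e ∈ W) :
    monIdeal k U ≤ monIdeal k W := fun _ hg e he ↦ hg e fun heU ↦ he (h e heU)

lemma monIdeal_inf {U W T : UpperSet (V →₀ ℕ)} (h : ∀ e, e ∈ T ↔ e ∈ U ∧ e ∈ W) :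
    monIdeal k T = monIdeal k U ⊓ monIdeal k W := by
  ext g
  simp only [Submodule.mem_inf, mem_monIdeal, h]
  grind

lemma mem_monIdeal_colon {U K : UpperSet (V →₀ ℕ)} {a : V →₀ ℕ} (hK : ∀ e, e ∈ K ↔ a + e ∈ U)
    (g : MvPolynomial V k) : g ∈ monIdeal k K ↔ monomial a 1 * g ∈ monIdeal k U := by
  constructor
  · intro hg e he
    rw [coeff_monomial_mul']
    split_ifs with hae
    · rw [hg, mul_zero]
      rwa [hK, add_tsub_cancel_of_le hae]
    · rfl
  · intro hg e he
    have := hg (a + e) (by rwa [← hK])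
    rwa [coeff_monomial_mul, one_mul] at this

lemma mem_monIdeal_add {U L : UpperSet (V →₀ ℕ)} {a : V →₀ ℕ} (hL : ∀ e, e ∈ L ↔ e ∈ U ∨ a ≤ e)
    (g : MvPolynomial V k) :
    g ∈ monIdeal k L ↔ ∃ b, g - monomial a 1 * b ∈ monIdeal k U := by
  constructor
  · intro hg
    refine ⟨divMonomial g a, fun e he ↦ ?_⟩
    have : g - monomial a 1 * divMonomial g a = modMonomial g a :=
      sub_eq_iff_eq_add'.2 (divMonomial_add_modMonomial g a).symm
    rw [this]
    by_cases hae : a ≤ e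
    · exact coeff_modMonomial_of_le _ hae
    · rw [coeff_modMonomial_of_not_le _ hae]
      exact hg e (by simp [hL, he, hae])
  · rintro ⟨b, hb⟩ e he
    rw [hL, not_or] at he
    have := hb e he.1
    rwa [coeff_sub, coeff_monomial_mul', if_neg he.2, sub_zero] at this

variable (k) in
lemma X_mem_maxIdeal (v : V) : X v ∈ maxIdeal k V := Ideal.subset_span ⟨v, rfl⟩

open HLoc

lemma vanish_monIdeal_of_colon {U K L : UpperSet (V →₀ ℕ)} (a : V →₀ ℕ)
    (hK : ∀ e, e ∈ K ↔ a + e ∈ U) (hL : ∀ e, e ∈ L ↔ e ∈ U ∨ a ≤ e)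
    {J : Ideal (MvPolynomial V k)} {d : ℕ}
    (h₁ : Vanish J (MvPolynomial V k ⧸ monIdeal k K) d)
    (h₂ : Vanish J (MvPolynomial V k ⧸ monIdeal k L) d) :
    Vanish J (MvPolynomial V k ⧸ monIdeal k U) d :=
  Vanish.of_colon (mem_monIdeal_colon hK) (mem_monIdeal_add hL) h₁ h₂

lemma finitary_monIdeal_of_colon {U K L : UpperSet (V →₀ ℕ)} (a : V →₀ ℕ)
    (hK : ∀ e, e ∈ K ↔ a + e ∈ U) (hL : ∀ e, e ∈ L ↔ e ∈ U ∨ a ≤ e)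
    {J : Ideal (MvPolynomial V k)} {d : ℕ}
    (h₁ : Finitary J (MvPolynomial V k ⧸ monIdeal k K) d)
    (h₂ : Finitary J (MvPolynomial V k ⧸ monIdeal k L) d) :
    Finitary J (MvPolynomial V k ⧸ monIdeal k U) d :=
  Finitary.of_colon (mem_monIdeal_colon hK) (mem_monIdeal_add hL) h₁ h₂

lemma vanish_monIdeal_of_top {U : UpperSet (V →₀ ℕ)} (hU : ∀ e, e ∈ U)
    (J : Ideal (MvPolynomial V k)) (d : ℕ) :
    Vanish J (MvPolynomial V k ⧸ monIdeal k U) d := by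
  have : Subsingleton (MvPolynomial V k ⧸ monIdeal k U) := by
    rw [Ideal.Quotient.subsingleton_iff, Ideal.eq_top_iff_one]
    exact fun e he ↦ absurd (hU e) he
  exact Vanish.of_subsingleton d

/-- The upper set obtained by adjoining all exponents in which some variable of `Z` occurs with
exponent at least `s`. -/
def adjoinPow (U : UpperSet (V →₀ ℕ)) (Z : Finset V) (s : ℕ) : UpperSet (V →₀ ℕ) where
  carrier := {e | e ∈ U ∨ ∃ z ∈ Z, s ≤ e z}
  upper' := by
    rintro a b hab (h | ⟨z, hz, h⟩)
    · exact Or.inl (U.upper hab h)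
    · exact Or.inr ⟨z, hz, h.trans (hab z)⟩

lemma mem_adjoinPow {U : UpperSet (V →₀ ℕ)} {Z : Finset V} {s : ℕ} {e : V →₀ ℕ} :
    e ∈ adjoinPow U Z s ↔ e ∈ U ∨ ∃ z ∈ Z, s ≤ e z := Iff.rfl

/-- An upper set does not depend on the variable `v`. -/
def IndepOf (U : UpperSet (V →₀ ℕ)) (v : V) : Prop :=
  ∀ e t, Finsupp.single v t + e ∈ U → e ∈ U

lemma IndepOf.adjoinPow {U : UpperSet (V →₀ ℕ)} {v : V} (h : IndepOf U v) {Z : Finset V}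
    (hv : v ∉ Z) (s : ℕ) : IndepOf (adjoinPow U Z s) v := by
  rintro e t (he | ⟨z, hz, he⟩)
  · exact Or.inl (h e t he)
  · refine Or.inr ⟨z, hz, ?_⟩
    have : z ≠ v := fun h ↦ hv (h ▸ hz)
    simpa [Finsupp.single_apply, this.symm] using he

lemma IndepOf.regular {U : UpperSet (V →₀ ℕ)} {v : V} (h : IndepOf U v) (t : ℕ)
    (g : MvPolynomial V k) (hg : monomial (Finsupp.single v t) 1 * g ∈ monIdeal k U) :
    g ∈ monIdeal k U :=
  (mem_monIdeal_colon (fun e ↦ ⟨fun he ↦ U.upper le_add_self he, h e t⟩) g).2 hg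

lemma mem_adjoinPow_insert [DecidableEq V] {U : UpperSet (V →₀ ℕ)} {Z : Finset V} {v : V} {s : ℕ}
    (e : V →₀ ℕ) :
    e ∈ adjoinPow U (insert v Z) s ↔ e ∈ adjoinPow U Z s ∨ Finsupp.single v s ≤ e := by
  simp only [mem_adjoinPow, Finset.mem_insert, Finsupp.single_le_iff]
  grind

/-- Vanishing of local cohomology when enough variables are free. -/
lemma vanish_of_indepOf (U : UpperSet (V →₀ ℕ)) (F : Finset V) (hF : ∀ v ∈ F, IndepOf U v) :
    Vanish (maxIdeal k V) (MvPolynomial V k ⧸ monIdeal k U) F.card := by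
  classical
  induction F using Finset.induction_on generalizing U with
  | empty => exact fun i hi ↦ absurd hi (Nat.not_lt_zero i)
  | insert v F hv ih =>
    rw [Finset.card_insert_of_notMem hv]
    refine Vanish.of_quotient_regular (f := monomial (Finsupp.single v 1) 1)
      (L := monIdeal k (adjoinPow U {v} 1)) (X_mem_maxIdeal k v)
      ((hF v (Finset.mem_insert_self v F)).regular 1)
      (mem_monIdeal_add fun e ↦ by simp [mem_adjoinPow]) (ih _ fun w hw ↦ ?_)
    refine (hF w (Finset.mem_insert_of_mem hw)).adjoinPow ?_ 1
    rw [Finset.mem_singleton]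
    rintro rfl
    exact hv hw

/-- Killing elements for local cohomology modulo powers of free variables. -/
lemma kills_adjoinPow (U : UpperSet (V →₀ ℕ)) (F : Finset V) (hF : ∀ v ∈ F, IndepOf U v) (s : ℕ)
    {J : Ideal (MvPolynomial V k)} {z : MvPolynomial V k} {d : ℕ}
    (hz : Kills z (MvPolynomial V k ⧸ monIdeal k U) J (d + F.card)) :
    Kills (z ^ 2 ^ F.card) (MvPolynomial V k ⧸ monIdeal k (adjoinPow U F s)) J d := by
  classical
  induction F using Finset.induction_on generalizing d with
  | empty =>
    have : adjoinPow U ∅ s = U := SetLike.ext fun e ↦ by simp [mem_adjoinPow]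
    rw [this]
    simpa using hz
  | insert v F hv ih =>
    rw [Finset.card_insert_of_notMem hv, ← add_assoc, add_right_comm] at hz
    have := ih (fun w hw ↦ hF w (Finset.mem_insert_of_mem hw)) hz
    rw [Finset.card_insert_of_notMem hv, pow_succ, mul_two, pow_add]
    exact Kills.of_quotient_regular (f := monomial (Finsupp.single v s) 1)
      (((hF v (Finset.mem_insert_self v F)).adjoinPow hv s).regular s)
      (mem_monIdeal_add mem_adjoinPow_insert) this

/-- Linear forms involving a free variable are regular. -/
lemma IndepOf.regular_sum {U : UpperSet (V →₀ ℕ)} {w : V} (h : IndepOf U w) {T : Finset V}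
    (hw : w ∈ T) (g : MvPolynomial V k) (hg : (∑ v ∈ T, X v) * g ∈ monIdeal k U) :
    g ∈ monIdeal k U := by
  classical
  by_contra hgU
  simp only [mem_monIdeal, not_forall] at hgU
  obtain ⟨e₀, he₀, hc₀⟩ := hgU
  obtain ⟨e, he, hmax⟩ := Finset.exists_max_image (g.support.filter (· ∉ U)) (fun e ↦ e w)
    ⟨e₀, by simp [he₀, hc₀]⟩
  simp only [Finset.mem_filter, mem_support_iff] at he hmax
  have hnot : Finsupp.single w 1 + e ∉ U := fun h' ↦ he.2 (h e 1 h')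
  have h0 := hg _ hnot
  rw [Finset.sum_mul, coeff_sum, Finset.sum_eq_single_of_mem w hw] at h0
  · rw [X, coeff_monomial_mul, one_mul] at h0
    exact he.1 h0
  · intro v _ hvw
    rw [coeff_X_mul']
    split_ifs with hv
    · by_contra hc
      have hle : Finsupp.single w 1 + e - Finsupp.single v 1 ≤ Finsupp.single w 1 + e :=
        tsub_le_self
      have := hmax _ ⟨hc, fun h' ↦ hnot (U.upper hle h')⟩
      simp [hvw] at this
    · rfl

/-- The exponents of total degree at least `m` in the variables of `s`. -/
def degSet (s : Finset V) (m : ℕ) : UpperSet (V →₀ ℕ) where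
  carrier := {e | m ≤ ∑ v ∈ s, e v}
  upper' _ _ hab h := le_trans (α := ℕ) h (Finset.sum_le_sum fun v _ ↦ hab v)

lemma mem_degSet {s : Finset V} {m : ℕ} {e : V →₀ ℕ} :
    e ∈ degSet s m ↔ m ≤ ∑ v ∈ s, e v := Iff.rfl

lemma indepOf_degSet {s : Finset V} {v : V} (hv : v ∉ s) (m : ℕ) : IndepOf (degSet s m) v := by
  intro e t h
  rw [mem_degSet] at h ⊢
  refine h.trans (Finset.sum_le_sum fun w hw ↦ ?_)
  have : v ≠ w := fun h ↦ hv (h ▸ hw)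
  simp [this]

lemma span_X_pow (s : Finset V) (m : ℕ) :
    Ideal.span ((X : V → MvPolynomial V k) '' s) ^ m = monIdeal k (degSet s m) := by
  apply le_antisymm
  · induction m with
    | zero => exact fun g _ e he ↦ absurd (Nat.zero_le _) he
    | succ m ih =>
      rw [pow_succ', Ideal.mul_le]
      intro a ha b hb
      induction ha using Submodule.span_induction with
      | mem a ha =>
        classical
        obtain ⟨v, hv, rfl⟩ := ha
        refine (mem_monIdeal_colon (K := degSet s m) (a := Finsupp.single v 1)
          (U := degSet s (m + 1)) (fun e ↦ ?_) b).1 (ih hb)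
        simp [mem_degSet, Finset.sum_add_distrib, Finsupp.single_apply, Finset.mem_coe.1 hv,
          add_comm 1]
      | zero => simp
      | add a c _ _ ha hc =>
        rw [add_mul]
        exact add_mem ha hc
      | smul r a _ ha =>
        rw [smul_mul_assoc]
        exact Submodule.smul_mem _ _ ha
  · intro g hg
    rw [g.as_sum]
    refine sum_mem fun e he ↦ ?_
    have he' : m ≤ ∑ v ∈ s, e v := by
      by_contra h
      exact mem_support_iff.1 he (hg e h)
    have hprod : ∏ v ∈ s, (X v : MvPolynomial V k) ^ e v ∈
        Ideal.span ((X : V → MvPolynomial V k) '' s) ^ ∑ v ∈ s, e v := by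
      rw [← Finset.prod_pow_eq_pow_sum]
      exact Ideal.prod_mem_prod fun v hv ↦
        Ideal.pow_mem_pow (Ideal.subset_span (Set.mem_image_of_mem _ hv)) _
    refine Ideal.pow_le_pow_right he' (Ideal.mem_of_dvd _ ?_ hprod)
    classical
    rw [monomial_eq, Finsupp.prod, ← Finset.prod_filter_of_ne (p := (· ∈ e.support))]
    · refine Dvd.dvd.mul_left (Finset.prod_dvd_prod_of_subset _ _ _ fun v hv ↦ ?_) _
      exact (Finset.mem_filter.1 hv).2
    · intro v _ hv
      rw [Finsupp.mem_support_iff]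
      rintro h
      simp [h] at hv

end MonomialIdeal

section SymbolicPower

variable (k : Type) [Field k] {V : Type}

instance maxIdeal_isMaximal : (maxIdeal k V).IsMaximal := by
  have h : maxIdeal k V = RingHom.ker (constantCoeff : MvPolynomial V k →+* k) := by
    ext g
    rw [maxIdeal, ← Set.image_univ, mem_ideal_span_X_image, RingHom.mem_ker, constantCoeff_eq]
    constructor
    · intro h
      by_contra h0
      simpa using h 0 (mem_support_iff.2 h0)
    · intro h m hm
      by_contra! hm'
      obtain rfl : m = 0 := Finsupp.ext fun v ↦ hm' v trivial
      exact mem_support_iff.1 hm h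
  rw [h]
  exact RingHom.ker_isMaximal_of_surjective _ fun c ↦ ⟨C c, constantCoeff_C V c⟩

section Dimension

variable [Fintype V]

lemma ringKrullDim_quotient_facePrime_le (F : Finset V) :
    ringKrullDim (MvPolynomial V k ⧸ facePrime k F) ≤ F.card := by
  let φ : MvPolynomial F k →ₐ[k] MvPolynomial V k ⧸ facePrime k F :=
    aeval fun v ↦ Ideal.Quotient.mk _ (X v.1)
  have hφ : Function.Surjective φ := by
    rw [← AlgHom.range_eq_top, eq_top_iff]
    rintro x -
    obtain ⟨g, rfl⟩ := Ideal.Quotient.mk_surjective x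
    induction g using MvPolynomial.induction_on with
    | C a => exact φ.range.algebraMap_mem a
    | add p q hp hq => rw [map_add]; exact add_mem hp hq
    | mul_X p v hp =>
      rw [map_mul]
      refine mul_mem hp ?_
      by_cases hv : v ∈ F
      · exact ⟨X ⟨v, hv⟩, by simp [φ]⟩
      · have h0 : Ideal.Quotient.mk (facePrime k F) (X v) = 0 :=
          Ideal.Quotient.eq_zero_iff_mem.2 (Ideal.subset_span (Set.mem_image_of_mem X hv))
        rw [h0]
        exact zero_mem _
  refine (ringKrullDim_le_of_surjective φ.toRingHom hφ).trans ?_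
  rw [MvPolynomial.ringKrullDim_of_isNoetherianRing, ringKrullDim_eq_zero_of_field]
  simp

lemma le_ringKrullDim_of_le_facePrime {I : Ideal (MvPolynomial V k)} {F : Finset V}
    (hI : I ≤ facePrime k F) : (F.card : WithBot ℕ∞) ≤ ringKrullDim (MvPolynomial V k ⧸ I) := by
  classical
  let φ : MvPolynomial V k →ₐ[k] MvPolynomial F k :=
    aeval fun v ↦ if hv : v ∈ F then X ⟨v, hv⟩ else 0
  have hker : facePrime k F ≤ RingHom.ker φ.toRingHom := by
    rw [facePrime, Ideal.span_le]
    rintro _ ⟨v, hv, rfl⟩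
    have : v ∉ F := hv
    simp [φ, this]
  have hsurj : Function.Surjective φ := by
    rw [← AlgHom.range_eq_top, eq_top_iff, ← MvPolynomial.adjoin_range_X, Algebra.adjoin_le_iff]
    rintro _ ⟨v, rfl⟩
    exact ⟨X v.1, by simp [φ]⟩
  have := ringKrullDim_le_of_surjective (Ideal.Quotient.lift I φ.toRingHom fun a ha ↦ hker (hI ha))
    (Ideal.Quotient.lift_surjective_of_surjective _ _ hsurj)
  rw [MvPolynomial.ringKrullDim_of_isNoetherianRing, ringKrullDim_eq_zero_of_field] at this
  simpa using this

lemma ringKrullDim_quotient_symbolicPower_le (Δ : Set (Finset V)) (m : ℕ) {D : ℕ}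
    (hD : ∀ F ∈ facets Δ, F.card ≤ D) :
    ringKrullDim (MvPolynomial V k ⧸ symbolicPower k Δ m) ≤ D := by
  classical
  rw [ringKrullDim_quotient]
  refine iSup_le fun p ↦ ?_
  have hmem : (⨅ F ∈ facets Δ, facePrime k F ^ m) ≤ p.head.1.asIdeal := p.head.2
  have hfin : (⨅ F ∈ facets Δ, facePrime k F ^ m) =
      (Finset.univ.filter (· ∈ facets Δ)).inf fun F ↦ facePrime k F ^ m := by
    simp [Finset.inf_eq_iInf]
  rw [hfin, (p.head.1.isPrime).inf_le'] at hmem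
  obtain ⟨F, hF, hle⟩ := hmem
  have hle : facePrime k F ≤ p.head.1.asIdeal := Ideal.IsPrime.le_of_pow_le hle
  let q : LTSeries (PrimeSpectrum.zeroLocus (facePrime k F : Set (MvPolynomial V k))) :=
    ⟨p.length, fun i ↦ ⟨(p i).1, hle.trans (LTSeries.head_le p i)⟩, fun i ↦ p.step i⟩
  have h1 : (p.length : WithBot ℕ∞) ≤ ringKrullDim (MvPolynomial V k ⧸ facePrime k F) := by
    rw [ringKrullDim_quotient]
    exact le_iSup (fun p : LTSeries _ ↦ (p.length : WithBot ℕ∞)) q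
  refine h1.trans ((ringKrullDim_quotient_facePrime_le k F).trans ?_)
  exact_mod_cast hD F (by simpa using hF)

omit [Fintype V] in
lemma symbolicPower_le_facePrime {Δ : Set (Finset V)} {F : Finset V} (hF : F ∈ facets Δ) {m : ℕ}
    (hm : m ≠ 0) : symbolicPower k Δ m ≤ facePrime k F :=
  (iInf₂_le F hF).trans (Ideal.pow_le_self hm)

variable {k}

open HLoc

lemma quotGCM_of_finitary {I : Ideal (MvPolynomial V k)} {D : ℕ}
    (hD : ringKrullDim (MvPolynomial V k ⧸ I) ≤ D)
    (h : Finitary (maxIdeal k V) (MvPolynomial V k ⧸ I) D) : quotGCM k V I := by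
  intro i hi
  have hi' : i < D := Nat.cast_lt.1 (lt_of_lt_of_le (α := WithBot ℕ∞) hi hD)
  have := h i hi'
  exact (LimExt.limEquivLocal _ _ i).isFiniteLength (HLoc.isFiniteLength i)

omit [Fintype V] in
lemma quotGCM.finitary {I : Ideal (MvPolynomial V k)} {D : ℕ}
    (hD : (D : WithBot ℕ∞) ≤ ringKrullDim (MvPolynomial V k ⧸ I))
    (h : quotGCM k V I) : Finitary (maxIdeal k V) (MvPolynomial V k ⧸ I) D := by
  intro i hi
  have hi' : (i : WithBot ℕ∞) < ringKrullDim (MvPolynomial V k ⧸ I) :=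
    lt_of_lt_of_le (by exact_mod_cast hi) hD
  exact (isFiniteLength_iff_isNoetherian_isArtinian.1
    ((LimExt.limEquivLocal _ _ i).symm.isFiniteLength (h i hi'))).1

end Dimension

variable {k}

/-- The exponents having degree at least two off every facet containing `F`. -/
def symSet [Fintype V] [DecidableEq V] (Δ : Set (Finset V)) (F : Finset V) :
    UpperSet (V →₀ ℕ) where
  carrier := {e | ∀ A ∈ facets Δ, F ⊆ A → 2 ≤ ∑ v ∈ Aᶜ, e v}
  upper' _ _ hab h A hA hFA :=
    le_trans (α := ℕ) (h A hA hFA) (Finset.sum_le_sum fun v _ ↦ hab v)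

variable [Fintype V] [DecidableEq V]

lemma mem_symSet {Δ : Set (Finset V)} {F : Finset V} {e : V →₀ ℕ} :
    e ∈ symSet Δ F ↔ ∀ A ∈ facets Δ, F ⊆ A → 2 ≤ ∑ v ∈ Aᶜ, e v := Iff.rfl

lemma facePrime_pow (F : Finset V) (m : ℕ) : facePrime k F ^ m = monIdeal k (degSet Fᶜ m) := by
  rw [← span_X_pow, facePrime]
  congr 3
  ext v
  simp

lemma symbolicPower_eq_monIdeal (Δ : Set (Finset V)) :
    symbolicPower k Δ 2 = monIdeal k (symSet Δ ∅) := by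
  ext g
  simp only [symbolicPower, facePrime_pow, Submodule.mem_iInf, mem_monIdeal, mem_symSet, mem_degSet]
  push Not
  simp only [Finset.empty_subset, true_and]
  exact ⟨fun h e ⟨A, hA, he⟩ ↦ h A hA e he, fun h A hA e he ↦ h e ⟨A, hA, he⟩⟩

end SymbolicPower

section Sufficiency

variable {k : Type} [Field k] {V : Type}

open HLoc

/-- The exponents `e` with `a + e` in an upper set. -/
def colonSet (U : UpperSet (V →₀ ℕ)) (a : V →₀ ℕ) : UpperSet (V →₀ ℕ) where
  carrier := {e | a + e ∈ U}
  upper' _ _ hab h := U.upper (add_le_add_right hab a) h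

/-- The upper set obtained by adjoining the exponents above `a`. -/
def adjoinExp (U : UpperSet (V →₀ ℕ)) (a : V →₀ ℕ) : UpperSet (V →₀ ℕ) where
  carrier := {e | e ∈ U ∨ a ≤ e}
  upper' _ _ hab h := h.imp (U.upper hab) fun h' ↦ h'.trans hab

lemma mem_colonSet {U : UpperSet (V →₀ ℕ)} {a e : V →₀ ℕ} : e ∈ colonSet U a ↔ a + e ∈ U := Iff.rfl

lemma mem_adjoinExp {U : UpperSet (V →₀ ℕ)} {a e : V →₀ ℕ} :
    e ∈ adjoinExp U a ↔ e ∈ U ∨ a ≤ e := Iff.rfl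

lemma vanish_of_colonSet {U : UpperSet (V →₀ ℕ)} (a : V →₀ ℕ)
    {J : Ideal (MvPolynomial V k)} {d : ℕ}
    (h₁ : Vanish J (MvPolynomial V k ⧸ monIdeal k (colonSet U a)) d)
    (h₂ : Vanish J (MvPolynomial V k ⧸ monIdeal k (adjoinExp U a)) d) :
    Vanish J (MvPolynomial V k ⧸ monIdeal k U) d :=
  vanish_monIdeal_of_colon a (fun _ ↦ Iff.rfl) (fun _ ↦ Iff.rfl) h₁ h₂

variable [DecidableEq V]

/-- The upper set of the `c`-th symbolic power of the edge ideal of the matching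
`{r, p r}`, `r ∈ R`, together with the variables of `Z`. -/
def pairSet (p : V → V) (R : Finset V) (c : ℕ) (Z : Finset V) : UpperSet (V →₀ ℕ) where
  carrier := {e | c ≤ ∑ r ∈ R, min (e r) (e (p r)) ∨ ∃ z ∈ Z, 1 ≤ e z}
  upper' _ _ hab h := h.imp
    (fun h ↦ le_trans (α := ℕ) h (Finset.sum_le_sum fun _ _ ↦ min_le_min (hab _) (hab _)))
    fun ⟨z, hz, h⟩ ↦ ⟨z, hz, h.trans (hab z)⟩

omit [DecidableEq V] in
lemma mem_pairSet {p : V → V} {R : Finset V} {c : ℕ} {Z : Finset V} {e : V →₀ ℕ} :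
    e ∈ pairSet p R c Z ↔ c ≤ ∑ r ∈ R, min (e r) (e (p r)) ∨ ∃ z ∈ Z, 1 ≤ e z := Iff.rfl

lemma vanish_pairSet [Fintype V] (p : V → V) (R : Finset V) (hinj : Set.InjOn p R)
    (hpR : ∀ r ∈ R, p r ∉ R) (c : ℕ) (Z : Finset V) (hZ : ∀ z ∈ Z, z ∉ R ∧ ∀ r ∈ R, z ≠ p r) {d : ℕ}
    (hd : d + R.card + Z.card ≤ Fintype.card V) :
    Vanish (maxIdeal k V) (MvPolynomial V k ⧸ monIdeal k (pairSet p R c Z)) d := by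
  induction R using Finset.induction_on generalizing c Z with
  | empty =>
    cases c with
    | zero => exact vanish_monIdeal_of_top (fun e ↦ Or.inl (Nat.zero_le _)) _ _
    | succ c =>
      refine (vanish_of_indepOf _ Zᶜ fun v hv e t ↦ ?_).mono ?_
      · simp only [mem_pairSet, Finset.sum_empty]
        rintro (h | ⟨z, hz, h⟩)
        · exact Or.inl h
        · refine Or.inr ⟨z, hz, ?_⟩
          have : v ≠ z := by
            rintro rfl
            exact Finset.mem_compl.1 hv hz
          simpa [Finsupp.single_apply, this] using h
      · rw [Finset.card_compl]
        simp at hd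
        lia
  | insert r R hr ih =>
    rw [Finset.card_insert_of_notMem hr] at hd
    have hprr : p r ≠ r ∧ p r ∉ R := by simpa using hpR r (Finset.mem_insert_self r R)
    have hR : ∀ x ∈ R, x ≠ r ∧ x ≠ p r ∧ p x ≠ r ∧ p x ≠ p r := by
      intro x hx
      have hx' : x ∈ insert r R := Finset.mem_insert_of_mem hx
      have hxr : x ≠ r := fun h ↦ hr (h ▸ hx)
      refine ⟨hxr, fun h ↦ hprr.2 (h ▸ hx), fun h ↦ hpR x hx' (h ▸ Finset.mem_insert_self r R),
        fun h ↦ hxr (hinj hx' (Finset.mem_insert_self r R) h)⟩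
    have hZr : ∀ z ∈ Z, z ≠ r ∧ z ≠ p r ∧ z ∉ R ∧ ∀ x ∈ R, z ≠ p x := by
      intro z hz
      have := hZ z hz
      simp only [Finset.mem_insert] at this
      grind
    have hinj' : Set.InjOn p R := hinj.mono (Finset.coe_subset.2 (Finset.subset_insert r R))
    have hpR' : ∀ x ∈ R, p x ∉ R := fun x hx h ↦
      hpR x (Finset.mem_insert_of_mem hx) (Finset.mem_insert_of_mem h)
    have ih' : ∀ c y, y = r ∨ y = p r → Vanish (maxIdeal k V)
        (MvPolynomial V k ⧸ monIdeal k (pairSet p R c (insert y Z))) d := by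
      intro c y hy
      have hyZ : y ∉ Z := fun h ↦ by have := hZr y h; grind
      refine ih hinj' hpR' c _ ?_ (by rw [Finset.card_insert_of_notMem hyZ]; lia)
      intro z hz
      rw [Finset.mem_insert] at hz
      rcases hz with rfl | hz
      · rcases hy with rfl | rfl
        · exact ⟨hr, fun x hx ↦ (hR x hx).2.2.1.symm⟩
        · exact ⟨hprr.2, fun x hx ↦ (hR x hx).2.2.2.symm⟩
      · exact (hZr z hz).2.2
    induction c with
    | zero => exact vanish_monIdeal_of_top (fun e ↦ Or.inl (Nat.zero_le _)) _ _
    | succ c ihc =>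
      have hsum : ∀ e a : V →₀ ℕ, (∀ v, v ≠ r → v ≠ p r → a v = 0) →
          ∑ x ∈ R, min ((a + e) x) ((a + e) (p x)) = ∑ x ∈ R, min (e x) (e (p x)) := by
        intro e a ha
        refine Finset.sum_congr rfl fun x hx ↦ ?_
        have := hR x hx
        simp [ha x this.1 this.2.1, ha (p x) this.2.2.1 this.2.2.2]
      have hsumZ : ∀ e a : V →₀ ℕ, (∀ v, v ≠ r → v ≠ p r → a v = 0) →
          ((∃ z ∈ Z, 1 ≤ (a + e) z) ↔ ∃ z ∈ Z, 1 ≤ e z) := by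
        intro e a ha
        refine exists_congr fun z ↦ and_congr_right fun hz ↦ ?_
        simp [ha z (hZr z hz).1 (hZr z hz).2.1]
      set a : V →₀ ℕ := Finsupp.single r 1 + Finsupp.single (p r) 1 with ha
      have ha0 : ∀ v, v ≠ r → v ≠ p r → a v = 0 := fun v h1 h2 ↦ by
        simp [ha, h1.symm, h2.symm]
      have har : a r = 1 := by simp [ha, hprr.1]
      have hap : a (p r) = 1 := by simp [ha, hprr.1.symm]
      have hale : ∀ e : V →₀ ℕ, a ≤ e ↔ 1 ≤ e r ∧ 1 ≤ e (p r) := by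
        intro e
        refine ⟨fun h ↦ ⟨har ▸ h r, hap ▸ h (p r)⟩, fun h v ↦ ?_⟩
        by_cases h1 : v = r
        · subst h1; rw [har]; exact h.1
        · by_cases h2 : v = p r
          · subst h2; rw [hap]; exact h.2
          · rw [ha0 v h1 h2]; exact Nat.zero_le _
      refine vanish_of_colonSet a ?_ (vanish_of_colonSet (Finsupp.single r 1) ?_ ?_)
      · have : colonSet (pairSet p (insert r R) (c + 1) Z) a = pairSet p (insert r R) c Z := by
          refine SetLike.ext fun e ↦ ?_
          rw [mem_colonSet, mem_pairSet, mem_pairSet, Finset.sum_insert hr, Finset.sum_insert hr,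
            hsum e a ha0, hsumZ e a ha0, Finsupp.add_apply a, Finsupp.add_apply a, har, hap]
          grind
        rw [this]
        exact ihc
      · have : colonSet (adjoinExp (pairSet p (insert r R) (c + 1) Z) a) (Finsupp.single r 1) =
            pairSet p R (c + 1) (insert (p r) Z) := by
          refine SetLike.ext fun e ↦ ?_
          have hs0 : ∀ v, v ≠ r → v ≠ p r → Finsupp.single r 1 v = 0 := fun v h1 _ ↦ by
            simp [h1.symm]
          rw [mem_colonSet, mem_adjoinExp, hale, mem_pairSet, mem_pairSet, Finset.sum_insert hr,
            hsum e _ hs0, hsumZ e _ hs0, Finset.exists_mem_insert]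
          simp only [Finsupp.add_apply, Finsupp.single_apply, hprr.1.symm, if_true, if_false]
          grind
        rw [this]
        exact ih' _ _ (Or.inr rfl)
      · have : adjoinExp (adjoinExp (pairSet p (insert r R) (c + 1) Z) a) (Finsupp.single r 1) =
            pairSet p R (c + 1) (insert r Z) := by
          refine SetLike.ext fun e ↦ ?_
          rw [mem_adjoinExp, mem_adjoinExp, hale, mem_pairSet, mem_pairSet, Finset.sum_insert hr,
            Finset.exists_mem_insert, Finsupp.single_le_iff]
          grind
        rw [this]
        exact ih' _ _ (Or.inl rfl)

variable [Fintype V]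

lemma quotGCM_symbolicPower_of_finitary {Δ : Set (Finset V)} {D : ℕ}
    (hD : ∀ F ∈ facets Δ, F.card ≤ D)
    (h : Finitary (maxIdeal k V) (MvPolynomial V k ⧸ monIdeal k (symSet Δ ∅)) D) :
    quotGCM k V (symbolicPower k Δ 2) := by
  refine quotGCM_of_finitary (ringKrullDim_quotient_symbolicPower_le k Δ 2 hD) ?_
  rwa [symbolicPower_eq_monIdeal]

lemma quotGCM_of_disjoint_edges [LinearOrder V] (G : SimpleGraph V)
    (hG : ∀ v, ∃! w, G.Adj v w) : quotGCM k V (symbolicPower k (indepComplex G) 2) := by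
  choose p hp huniq using hG
  simp only at hp huniq
  have hpp : ∀ v, p (p v) = v := fun v ↦ (huniq (p v) v (hp v).symm).symm
  have hadj : ∀ v w, G.Adj v w ↔ w = p v := fun v w ↦ ⟨huniq v w, fun h ↦ h ▸ hp v⟩
  set R : Finset V := Finset.univ.filter fun v ↦ v < p v with hRdef
  have hR : ∀ v, v ∈ R ↔ v < p v := by simp [R]
  have hpR : ∀ v, p v ∈ R ↔ v ∉ R := by
    intro v
    have : p v ≠ v := (hp v).ne'
    rw [hR, hR, hpp]
    grind
  have hsum : ∀ f : V → ℕ, ∑ v, f v = ∑ r ∈ R, (f r + f (p r)) := by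
    intro f
    rw [← Finset.sum_add_sum_compl R, Finset.sum_add_distrib]
    congr 1
    refine Finset.sum_nbij' p p ?_ ?_ ?_ ?_ ?_ <;> intro v <;>
      simp [Finset.mem_compl, hpR, hpp]
  have hind : ∀ A, A ∈ indepComplex G ↔ ∀ v ∈ A, p v ∉ A := by
    intro A
    simp only [indepComplex, Set.mem_ofPred_eq, hadj]
    grind
  have hmem : symSet (indepComplex G) ∅ = pairSet p R 2 ∅ := by
    refine SetLike.ext fun e ↦ ?_
    rw [mem_symSet, mem_pairSet]
    simp only [Finset.empty_subset, Finset.notMem_empty, false_and, exists_false, or_false,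
      true_implies]
    have hcompl : ∀ A : Finset V, ∑ v ∈ Aᶜ, e v =
        ∑ r ∈ R, ((if r ∈ A then 0 else e r) + if p r ∈ A then 0 else e (p r)) := by
      intro A
      rw [← hsum fun v ↦ if v ∈ A then 0 else e v, ← Finset.sum_add_sum_compl A,
        Finset.sum_ite_of_true (fun _ h ↦ h),
        Finset.sum_ite_of_false (fun _ h ↦ Finset.mem_compl.1 h)]
      simp
    constructor
    · intro h
      let A : Finset V := Finset.univ.filter fun v ↦
        (v ∈ R ∧ e (p v) ≤ e v) ∨ (v ∉ R ∧ e (p v) < e v)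
      have hA : ∀ v, v ∈ A ↔ (v ∈ R ∧ e (p v) ≤ e v) ∨ (v ∉ R ∧ e (p v) < e v) := by simp [A]
      have hpA : ∀ v, p v ∈ A ↔ v ∉ A := by
        intro v
        rw [hA, hA, hpR, hpp]
        grind
      have := h A ⟨(hind A).2 fun v hv ↦ by rw [hpA]; simpa, fun B hB hAB ↦ ?_⟩
      · rw [hcompl] at this
        refine this.trans (Finset.sum_le_sum fun r hr ↦ ?_)
        have h1 := hpA r
        have h2 := hA r
        split_ifs <;> grind
      · refine hAB.antisymm fun v hv ↦ ?_
        by_contra hvA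
        exact (hind B).1 hB v hv (hAB ((hpA v).2 hvA))
    · intro h A hA
      rw [hcompl]
      refine h.trans (Finset.sum_le_sum fun r hr ↦ ?_)
      have := (hind A).1 hA.1 r
      split_ifs <;> grind
  have hcardV : Fintype.card V = R.card + R.card := by
    have := hsum fun _ ↦ 1
    simpa [mul_two] using this
  refine quotGCM_symbolicPower_of_finitary (D := R.card) (fun A hA ↦ ?_) ?_
  · have h1 := hsum fun v ↦ if v ∈ A then 1 else 0
    rw [← Finset.sum_filter, Finset.filter_mem_eq_inter, Finset.univ_inter,
      ← Finset.card_eq_sum_ones] at h1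
    rw [h1, Finset.card_eq_sum_ones]
    refine Finset.sum_le_sum fun r _ ↦ ?_
    have := (hind A).1 hA.1 r
    split_ifs <;> grind
  · rw [hmem]
    refine Vanish.finitary (vanish_pairSet p R ?_ ?_ 2 ∅ (by simp) (by simp [hcardV]))
    · intro x _ y _ h
      rw [← hpp x, ← hpp y, h]
    · intro r hr
      rw [hpR]
      simpa using hr

end Sufficiency

section Sufficiency

variable {k : Type} [Field k] {V : Type} [DecidableEq V] [Fintype V]

open HLoc

lemma sum_compl_eq_sum_ite (A : Finset V) (f : V → ℕ) :
    ∑ v ∈ Aᶜ, f v = ∑ v, if v ∈ A then 0 else f v := by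
  rw [← Finset.sum_add_sum_compl A, Finset.sum_ite_of_true (fun _ h ↦ h),
    Finset.sum_ite_of_false (fun _ h ↦ Finset.mem_compl.1 h)]
  simp

lemma maxIdeal_pow_le_sup (A : Finset V) :
    maxIdeal k V ^ (2 + 2) ≤ monIdeal k (degSet A 2) ⊔ monIdeal k (degSet Aᶜ 2) := by
  rw [← span_X_pow, ← span_X_pow]
  refine le_trans ?_ (Ideal.sup_pow_add_le_pow_sup_pow)
  rw [← Ideal.span_union, ← Set.image_union, maxIdeal, ← Set.image_univ]
  refine Ideal.pow_right_mono (Ideal.span_mono (Set.image_mono fun v _ ↦ ?_)) _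
  by_cases hv : v ∈ A <;> simp

lemma quotGCM_of_completeBipartite (G : SimpleGraph V) (A : Finset V)
    (hadj : ∀ v w, G.Adj v w ↔ (v ∈ A ↔ w ∉ A)) (hcard : Aᶜ.card = A.card) (hpos : A.Nonempty) :
    quotGCM k V (symbolicPower k (indepComplex G) 2) := by
  have hind : ∀ B, B ∈ indepComplex G ↔ B ⊆ A ∨ B ⊆ Aᶜ := by
    intro B
    simp only [indepComplex, Set.mem_ofPred_eq, hadj, Finset.subset_iff, Finset.mem_compl]
    grind
  have hpos' : Aᶜ.Nonempty := by rw [← Finset.card_pos, hcard, Finset.card_pos]; exact hpos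
  have hfac : ∀ B, B ∈ facets (indepComplex G) ↔ B = A ∨ B = Aᶜ := by
    intro B
    constructor
    · rintro ⟨h1, h2⟩
      rcases (hind B).1 h1 with h | h
      · exact Or.inl (h2 _ ((hind A).2 (Or.inl subset_rfl)) h)
      · exact Or.inr (h2 _ ((hind Aᶜ).2 (Or.inr subset_rfl)) h)
    · obtain ⟨x, hx⟩ := hpos
      obtain ⟨y, hy⟩ := hpos'
      rw [Finset.mem_compl] at hy
      rintro (rfl | rfl)
      · refine ⟨(hind _).2 (Or.inl subset_rfl), fun C hC h ↦ h.antisymm ?_⟩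
        rcases (hind C).1 hC with h' | h'
        · exact h'
        · exact absurd hx (Finset.mem_compl.1 (h' (h hx)))
      · refine ⟨(hind _).2 (Or.inr subset_rfl), fun C hC h ↦ h.antisymm ?_⟩
        rcases (hind C).1 hC with h' | h'
        · exact absurd (h' (h (Finset.mem_compl.2 hy))) hy
        · exact h'
  refine quotGCM_symbolicPower_of_finitary (D := A.card) ?_ ?_
  · intro F hF
    rcases (hfac F).1 hF with rfl | rfl
    · exact le_rfl
    · exact hcard.le
  · refine Finitary.of_inf (K := monIdeal k (degSet A 2)) (L := monIdeal k (degSet Aᶜ 2))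
      (monIdeal_inf fun e ↦ ?_) (maxIdeal_pow_le_sup A) ?_ ?_
    · simp only [mem_symSet, hfac, mem_degSet, Finset.empty_subset, true_implies, forall_eq_or_imp,
        forall_eq, compl_compl, and_comm]
    · exact ((vanish_of_indepOf _ Aᶜ fun v hv ↦ indepOf_degSet (Finset.mem_compl.1 hv) 2).mono
        hcard.ge).finitary
    · exact (vanish_of_indepOf _ A fun v hv ↦ indepOf_degSet (by simpa using hv) 2).finitary

section Path

variable {a b c d : V}

/-- The exponents of the monomials in the ideal `(z, x ^ i * y ^ j)`. -/
def tripleSet (x y z : V) (i j : ℕ) : UpperSet (V →₀ ℕ) where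
  carrier := {e | 1 ≤ e z ∨ (i ≤ e x ∧ j ≤ e y)}
  upper' _ _ hab h := h.imp (fun h ↦ h.trans (hab z)) fun h ↦
    ⟨h.1.trans (hab x), h.2.trans (hab y)⟩

omit [DecidableEq V] [Fintype V] in
lemma mem_tripleSet {x y z : V} {i j : ℕ} {e : V →₀ ℕ} :
    e ∈ tripleSet x y z i j ↔ 1 ≤ e z ∨ (i ≤ e x ∧ j ≤ e y) := Iff.rfl

omit [DecidableEq V] [Fintype V] in
lemma vanish_two_of_indepOf (U : UpperSet (V →₀ ℕ)) {v w : V} (hvw : v ≠ w) (hv : IndepOf U v)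
    (hw : IndepOf U w) : Vanish (maxIdeal k V) (MvPolynomial V k ⧸ monIdeal k U) 2 := by
  classical
  rw [← Finset.card_pair hvw]
  refine vanish_of_indepOf U _ fun x hx ↦ ?_
  rcases Finset.mem_insert.1 hx with rfl | hx
  · exact hv
  · rwa [Finset.mem_singleton.1 hx]

omit [DecidableEq V] [Fintype V] in
lemma vanish_tripleSet {x y z w : V} (hxy : x ≠ y) (hxz : x ≠ z) (hxw : x ≠ w) (hyz : y ≠ z)
    (hyw : y ≠ w) (hzw : z ≠ w) (i j : ℕ) :
    Vanish (maxIdeal k V) (MvPolynomial V k ⧸ monIdeal k (tripleSet x y z i j)) 2 := by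
  refine vanish_monIdeal_of_colon (Finsupp.single x i) (K := tripleSet x y z 0 j)
    (L := tripleSet x y z i 0) (fun e ↦ ?_) (fun e ↦ ?_)
    (vanish_two_of_indepOf _ hxw (fun e t ↦ ?_) fun e t ↦ ?_)
    (vanish_two_of_indepOf _ hyw (fun e t ↦ ?_) fun e t ↦ ?_)
  · simp [mem_tripleSet, hxy.symm, hxz.symm]
  · simp only [mem_tripleSet, Finsupp.single_le_iff]
    lia
  · simp [mem_tripleSet, hxz.symm, hxy.symm]
  · simp [mem_tripleSet, hzw, hyw]
  · simp [mem_tripleSet, hyz.symm, hxy]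
  · simp [mem_tripleSet, hzw, hxw]

lemma quotGCM_of_path (G : SimpleGraph V) (hab : a ≠ b) (hac : a ≠ c) (had : a ≠ d) (hbc : b ≠ c)
    (hbd : b ≠ d) (hcd : c ≠ d) (huniv : (Finset.univ : Finset V) = {a, b, c, d})
    (hadj : ∀ v w, G.Adj v w ↔ (v = a ∧ w = b) ∨ (v = b ∧ w = a) ∨ (v = b ∧ w = c) ∨
      (v = c ∧ w = b) ∨ (v = c ∧ w = d) ∨ (v = d ∧ w = c)) :
    quotGCM k V (symbolicPower k (indepComplex G) 2) := by
  have hsum : ∀ f : V → ℕ, ∑ v, f v = f a + (f b + (f c + f d)) := by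
    intro f
    rw [huniv, Finset.sum_insert (by simp [hab, hac, had]), Finset.sum_insert (by simp [hbc, hbd]),
      Finset.sum_insert (by simp [hcd]), Finset.sum_singleton]
  have hall : ∀ v, v = a ∨ v = b ∨ v = c ∨ v = d := fun v ↦ by
    have := Finset.mem_univ v
    rw [huniv] at this
    simpa using this
  have hind : ∀ A, A ∈ indepComplex G ↔
      ¬ (a ∈ A ∧ b ∈ A) ∧ ¬ (b ∈ A ∧ c ∈ A) ∧ ¬ (c ∈ A ∧ d ∈ A) := by
    intro A
    simp only [indepComplex, Set.mem_ofPred_eq, hadj]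
    grind
  have hfac : ∀ A : Finset V, A ∈ indepComplex G → (∀ v ∉ A, insert v A ∉ indepComplex G) →
      A ∈ facets (indepComplex G) := by
    refine fun A hA h ↦ ⟨hA, fun B hB hAB ↦ hAB.antisymm fun v hv ↦ ?_⟩
    by_contra hvA
    refine h v hvA fun x hx y hy ↦ hB x ?_ y ?_
    · exact Finset.insert_subset hv hAB hx
    · exact Finset.insert_subset hv hAB hy
  have hmem : ∀ e, e ∈ symSet (indepComplex G) ∅ ↔
      2 ≤ e b + e d ∧ 2 ≤ e b + e c ∧ 2 ≤ e a + e c := by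
    intro e
    rw [mem_symSet]
    simp only [Finset.empty_subset, true_implies, sum_compl_eq_sum_ite, hsum]
    constructor
    · intro h
      have h1 := h {a, c} (hfac _ (by rw [hind]; grind) fun v hv ↦ by
        rw [hind]; have := hall v; grind)
      have h2 := h {a, d} (hfac _ (by rw [hind]; grind) fun v hv ↦ by
        rw [hind]; have := hall v; grind)
      have h3 := h {b, d} (hfac _ (by rw [hind]; grind) fun v hv ↦ by
        rw [hind]; have := hall v; grind)
      simp [hab, hac, had, hbc, hbd, hcd, hab.symm, hac.symm, had.symm, hbc.symm, hbd.symm,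
        hcd.symm] at h1 h2 h3
      exact ⟨h1, h2, h3⟩
    · intro h A hA
      have := (hind A).1 hA.1
      split_ifs <;> grind
  refine quotGCM_symbolicPower_of_finitary (D := 2) ?_ ?_
  · intro A hA
    have := (hind A).1 hA.1
    have h1 := hsum fun v ↦ if v ∈ A then 1 else 0
    rw [← Finset.sum_filter, Finset.filter_mem_eq_inter, Finset.univ_inter,
      ← Finset.card_eq_sum_ones] at h1
    rw [h1]
    split_ifs <;> grind
  have hle : ∀ e : V →₀ ℕ, Finsupp.single b 1 + Finsupp.single c 1 ≤ e ↔ 1 ≤ e b ∧ 1 ≤ e c := by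
    intro e
    constructor
    · intro h
      have h1 := h b
      have h2 := h c
      simp [hbc, hbc.symm] at h1 h2
      exact ⟨h1, h2⟩
    · intro h v
      by_cases h1 : v = b
      · subst h1; simpa [hbc] using h.1
      · by_cases h2 : v = c
        · subst h2; simpa [hbc.symm] using h.2
        · simp [h1, h2]
  have hL : Vanish (maxIdeal k V) (MvPolynomial V k ⧸ monIdeal k (adjoinExp
      (symSet (indepComplex G) ∅) (Finsupp.single b 1 + Finsupp.single c 1))) 2 := by
    refine vanish_monIdeal_of_colon (Finsupp.single b 1) (K := tripleSet a b c 2 1)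
      (L := tripleSet c d b 2 2) (fun e ↦ ?_) (fun e ↦ ?_)
      (vanish_tripleSet hab hac had hbc hbd hcd 2 1)
      (vanish_tripleSet hcd hbc.symm hac.symm hbd.symm had.symm hab.symm 2 2)
    · rw [mem_adjoinExp, hle, hmem, mem_tripleSet]
      simp [hab.symm, hbc.symm, hbd.symm]
      lia
    · rw [mem_adjoinExp, hle, hmem, mem_tripleSet, Finsupp.single_le_iff]
      lia
  refine finitary_monIdeal_of_colon (K := colonSet _ _) (L := adjoinExp _ _)
    (Finsupp.single b 1 + Finsupp.single c 1) (fun _ ↦ Iff.rfl)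
    (fun _ ↦ Iff.rfl) (Finitary.of_inf (t := 1) (monIdeal_inf (U := tripleSet a d b 0 1)
      (W := tripleSet b c a 0 1) fun e ↦ ?_) ?_ ?_ ?_) hL.finitary
  · rw [mem_colonSet, hmem, mem_tripleSet, mem_tripleSet]
    simp [hab.symm, hbc.symm, hbd.symm, hac.symm, hbc, hcd.symm]
    lia
  · rw [pow_one, maxIdeal, Ideal.span_le]
    rintro _ ⟨v, rfl⟩
    have hv := hall v
    by_cases hv' : v = b ∨ v = d
    · refine Ideal.mem_sup_left (monomial_mem_monIdeal.2 ?_)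
      rw [mem_tripleSet, Finsupp.single_apply, Finsupp.single_apply, Finsupp.single_apply]
      grind
    · refine Ideal.mem_sup_right (monomial_mem_monIdeal.2 ?_)
      rw [mem_tripleSet, Finsupp.single_apply, Finsupp.single_apply, Finsupp.single_apply]
      grind
  · exact (vanish_tripleSet had hab hac hbd.symm hcd.symm hbc 0 1).finitary
  · exact (vanish_tripleSet hbc hab.symm hbd hac.symm hcd had 0 1).finitary

end Path

end Sufficiency

section Necessity

variable {k : Type} [Field k] {V : Type} [DecidableEq V]

open HLoc

/-- The exponent with value `t` on `F` and zero elsewhere. -/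
def constOn (F : Finset V) (t : ℕ) : V →₀ ℕ := ∑ v ∈ F, Finsupp.single v t

lemma constOn_apply (F : Finset V) (t : ℕ) (v : V) : constOn F t v = if v ∈ F then t else 0 := by
  simp [constOn, Finsupp.finsetSum_apply, Finsupp.single_apply]

lemma constOn_add (F : Finset V) (t u : ℕ) : constOn F t + constOn F u = constOn F (t + u) := by
  ext v
  simp only [Finsupp.add_apply, constOn_apply]
  split_ifs <;> rfl

lemma nsmul_constOn (F : Finset V) (t u : ℕ) : t • constOn F u = constOn F (t * u) := by
  ext v
  simp [constOn_apply]

lemma sum_constOn_eq_zero {F S : Finset V} (h : ∀ v ∈ S, v ∉ F) (t : ℕ) :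
    ∑ v ∈ S, constOn F t v = 0 :=
  Finset.sum_eq_zero fun v hv ↦ by rw [constOn_apply, if_neg (h v hv)]

lemma sum_single_apply (S : Finset V) (v : V) (t : ℕ) :
    ∑ w ∈ S, Finsupp.single v t w = if v ∈ S then t else 0 := by
  simp [Finsupp.single_apply]

variable [Fintype V] {Δ : Set (Finset V)} {F : Finset V}

lemma exists_kills_adjoinPow_symSet (hF : F.Nonempty) {d : ℕ}
    (h : Finitary (maxIdeal k V) (MvPolynomial V k ⧸ monIdeal k (symSet Δ ∅)) (d + F.card)) :
    ∃ t, ∀ s, Kills (monomial (constOn F t) (1 : k))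
      (MvPolynomial V k ⧸ monIdeal k (adjoinPow (symSet Δ F) F s)) (maxIdeal k V) d := by
  have hz : monomial (constOn F 1) (1 : k) ∈ maxIdeal k V := by
    obtain ⟨v, hv⟩ := hF
    refine Ideal.mem_of_dvd _ ?_ (X_mem_maxIdeal k v)
    refine (monomial_one_dvd_monomial_one (R := k)).2 ?_
    rw [Finsupp.single_le_iff, constOn_apply, if_pos hv]
  obtain ⟨t, ht⟩ := h.exists_kills hz
  have hle : ∀ g ∈ monIdeal k (symSet Δ F),
      monomial (constOn F 2) (1 : k) * g ∈ monIdeal k (symSet Δ ∅) := by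
    intro g hg
    refine (mem_monIdeal_colon (K := colonSet (symSet Δ ∅) (constOn F 2)) (fun _ ↦ Iff.rfl) g).1
      (monIdeal_mono (fun e he A hA _ ↦ ?_) hg)
    by_cases hFA : F ⊆ A
    · exact le_trans (α := ℕ) (he A hA hFA) (Finset.sum_le_sum fun v _ ↦ by simp)
    · obtain ⟨v, hv, hvA⟩ := Finset.not_subset.1 hFA
      refine le_trans (α := ℕ) ?_ (Finset.single_le_sum (fun _ _ ↦ Nat.zero_le _)
        (Finset.mem_compl.2 hvA))
      simp [constOn_apply, hv]
  have hI : monIdeal k (symSet Δ ∅) ≤ monIdeal k (symSet Δ F) :=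
    monIdeal_mono fun e he A hA _ ↦ he A hA (Finset.empty_subset A)
  have hk := ht.of_le hI hle
  refine ⟨2 ^ F.card * (t + 2), fun s ↦ ?_⟩
  have := kills_adjoinPow (symSet Δ F) F (fun v hv e u he A hA hFA ↦ ?_) s hk
  · rwa [monomial_pow, one_pow, nsmul_constOn, mul_one, monomial_mul, one_mul, constOn_add,
      monomial_pow, one_pow, nsmul_constOn] at this
  · refine le_trans (α := ℕ) (he A hA hFA) (Finset.sum_le_sum fun w hw ↦ ?_)
    have : v ≠ w := by
      rintro rfl
      exact Finset.mem_compl.1 hw (hFA hv)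
    simp [this]

omit [DecidableEq V] in
lemma maxIdeal_pow (t : ℕ) : maxIdeal k V ^ t = monIdeal k (degSet Finset.univ t) := by
  rw [← span_X_pow, maxIdeal, Finset.coe_univ, Set.image_univ]

/-- Facets have maximal cardinality when the low local cohomology is finitely generated. -/
lemma le_card_of_finitary (hF : F.Nonempty) (hFΔ : F ∈ facets Δ) {D : ℕ}
    (h : Finitary (maxIdeal k V) (MvPolynomial V k ⧸ monIdeal k (symSet Δ ∅)) D) :
    D ≤ F.card := by
  by_contra! hlt
  obtain ⟨t, ht⟩ := exists_kills_adjoinPow_symSet (d := 1) hF fun i hi ↦ h i (by lia)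
  have hsym : ∀ e, e ∈ symSet Δ F ↔ 2 ≤ ∑ v ∈ Fᶜ, e v := fun e ↦
    ⟨fun he ↦ he F hFΔ subset_rfl, fun he A hA hFA ↦ hFΔ.2 A hA.1 hFA ▸ he⟩
  have := (ht (t + 1)).mul_mem (d := 0) (g := 1) (t := 2 + F.card * t) ?_
  · rw [mul_one, monomial_mem_monIdeal, mem_adjoinPow, hsym,
      sum_constOn_eq_zero fun v hv ↦ Finset.mem_compl.1 hv] at this
    obtain h2 | ⟨v, hv, h2⟩ := this
    · lia
    · rw [constOn_apply, if_pos hv] at h2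
      lia
  · intro r hr
    rw [mul_one]
    rw [maxIdeal_pow] at hr
    refine monIdeal_mono (fun e he ↦ ?_) hr
    rw [mem_adjoinPow, hsym]
    by_contra! hne
    rw [mem_degSet, ← Finset.sum_add_sum_compl F] at he
    have : ∑ v ∈ F, e v ≤ F.card * t := by
      rw [← smul_eq_mul]
      exact Finset.sum_le_card_nsmul F _ _ fun v hv ↦ Nat.lt_succ_iff.1 (hne.2 v hv)
    lia

lemma mem_monIdeal_adjoinPow_symSet {s : ℕ} {g : MvPolynomial V k} :
    g ∈ monIdeal k (adjoinPow (symSet Δ F) F s) ↔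
      ∀ A ∈ facets Δ, F ⊆ A → g ∈ monIdeal k (adjoinPow (degSet Aᶜ 2) F s) := by
  constructor
  · exact fun h A hA hFA ↦ monIdeal_mono
      (fun e he ↦ (mem_adjoinPow.1 he).imp_left fun h ↦ h A hA hFA) h
  · intro h e he
    simp only [mem_adjoinPow, mem_symSet, not_or, not_forall] at he
    obtain ⟨⟨A, hA, hFA, he⟩, he'⟩ := he
    exact h A hA hFA e (by rw [mem_adjoinPow, mem_degSet]; exact not_or.2 ⟨he, he'⟩)

lemma regular_sum_adjoinPow {A : Finset V} {w : V} (hw : w ∈ A) (hwF : w ∉ F) {s : ℕ}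
    (g : MvPolynomial V k)
    (hg : (∑ v ∈ Fᶜ, X v) * g ∈ monIdeal k (adjoinPow (degSet Aᶜ 2) F s)) :
    g ∈ monIdeal k (adjoinPow (degSet Aᶜ 2) F s) :=
  ((indepOf_degSet (by simpa using hw) 2).adjoinPow hwF s).regular_sum
    (Finset.mem_compl.2 hwF) g hg

/-- Two facets that meet in `F` and are separated by an edge force the local cohomology to be
infinitely generated. -/
lemma not_finitary_of_facets {A B : Finset V} (hF : F.Nonempty) (hA : A ∈ facets Δ)
    (hB : B ∈ facets Δ) (hAB : A ∩ B = F) {p q : V} (hpA : p ∈ A) (hpB : p ∉ B) (hqB : q ∈ B)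
    (hqA : q ∉ A) (hfac : ∀ T ∈ facets Δ, F ⊆ T → T = A ∨ T = B ∨ (p ∉ T ∧ q ∉ T)) {D : ℕ}
    (hD : F.card + 2 ≤ D) :
    ¬ Finitary (maxIdeal k V) (MvPolynomial V k ⧸ monIdeal k (symSet Δ ∅)) D := by
  intro h
  obtain ⟨t, ht⟩ := exists_kills_adjoinPow_symSet (d := 2) hF fun i hi ↦ h i (by lia)
  have hFA : F ⊆ A := hAB ▸ Finset.inter_subset_left
  have hFB : F ⊆ B := hAB ▸ Finset.inter_subset_right
  have hpF : p ∉ F := fun h ↦ hpB (hFB h)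
  have hqF : q ∉ F := fun h ↦ hqA (hFA h)
  have hpq : p ≠ q := fun h ↦ hqA (h ▸ hpA)
  set s := 2 * t + 1 with hs
  set U := adjoinPow (symSet Δ F) F s with hU
  set ℓ : MvPolynomial V k := ∑ v ∈ Fᶜ, X v with hℓ
  set f : MvPolynomial V k := X p * X q with hf
  set u : MvPolynomial V k := ∑ w ∈ A \ F, X w with hu
  have hsplit : ℓ = u + ∑ w ∈ Aᶜ, X w := by
    rw [hℓ, hu, ← Finset.sum_sdiff (Finset.compl_subset_compl.2 hFA)]
    congr 2
    ext v
    simp [and_comm]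
  have hX : ∀ v w, f * X v * X w =
      monomial (Finsupp.single p 1 + Finsupp.single q 1 + Finsupp.single v 1 + Finsupp.single w 1)
        (1 : k) := by
    intro v w
    simp only [hf, X, monomial_mul, mul_one]
  have hX' : ∀ v, f * X v =
      monomial (Finsupp.single p 1 + Finsupp.single q 1 + Finsupp.single v 1) (1 : k) := by
    intro v
    simp only [hf, X, monomial_mul, mul_one]
  have hmem : ∀ v ∉ A, ∀ w ∈ A \ F, f * X v * X w ∈ monIdeal k U := by
    intro v hv w hw
    rw [hX, monomial_mem_monIdeal]
    refine Or.inl fun T hT hFT ↦ ?_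
    have hwB : w ∉ B := fun h ↦ (Finset.mem_sdiff.1 hw).2 (hAB ▸ Finset.mem_inter.2
      ⟨(Finset.mem_sdiff.1 hw).1, h⟩)
    simp only [Finsupp.add_apply, Finset.sum_add_distrib, sum_single_apply, Finset.mem_compl]
    rcases hfac T hT hFT with rfl | rfl | ⟨h1, h2⟩
    · simp [hqA, hv]; lia
    · simp [hpB, hwB]; lia
    · simp [h1, h2]; lia
  have hregU : ∀ g, ℓ * g ∈ monIdeal k U → g ∈ monIdeal k U := by
    intro g hg
    rw [mem_monIdeal_adjoinPow_symSet] at hg ⊢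
    intro T hT hFT
    obtain ⟨w, hwT, hwF⟩ : ∃ w ∈ T, w ∉ F := by
      by_contra! hTF
      have hTA : T = A := hT.2 A hA.1 fun v hv ↦ hFA (hTF v hv)
      exact hpF (hTF p (hTA ▸ hpA))
    exact regular_sum_adjoinPow hwT hwF g (hg T hT hFT)
  let W : Ideal (MvPolynomial V k) := monIdeal k U ⊔ Ideal.span {ℓ}
  have hW : ∀ g, g ∈ W ↔ ∃ a, g - ℓ * a ∈ monIdeal k U := by
    intro g
    simp only [W, Submodule.mem_sup, Ideal.mem_span_singleton']
    constructor
    · rintro ⟨y, hy, _, ⟨a, rfl⟩, rfl⟩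
      exact ⟨a, by rwa [mul_comm ℓ, add_sub_cancel_right]⟩
    · rintro ⟨a, ha⟩
      exact ⟨_, ha, _, ⟨a, rfl⟩, by ring⟩
  have hk := (ht s).of_quotient_regular (d := 1) hregU hW
  have hUW : monIdeal k U ≤ W := le_sup_left
  have hℓW : ℓ ∈ W := Ideal.mem_sup_right (Ideal.mem_span_singleton_self ℓ)
  have hrad : maxIdeal k V ≤ (W.colon (Ideal.span {f * u})).radical := by
    rw [maxIdeal, Ideal.span_le]
    rintro _ ⟨v, rfl⟩
    by_cases hvF : v ∈ F
    · refine ⟨s, Ideal.mem_colon_span_singleton.2 (Ideal.mul_mem_right _ _ (hUW ?_))⟩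
      rw [X_pow_eq_monomial, monomial_mem_monIdeal]
      exact Or.inr ⟨v, hvF, by simp⟩
    · refine ⟨1, Ideal.mem_colon_span_singleton.2 ?_⟩
      rw [pow_one]
      by_cases hvA : v ∈ A
      · have : X v * (f * u) = X v * f * ℓ - ∑ w ∈ Aᶜ, f * X w * X v := by
          rw [hsplit, ← Finset.sum_mul, ← Finset.mul_sum]
          ring
        rw [this]
        exact sub_mem (Ideal.mul_mem_left _ _ hℓW) (sum_mem fun w hw ↦ hUW
          (hmem w (Finset.mem_compl.1 hw) v (Finset.mem_sdiff.2 ⟨hvA, hvF⟩)))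
      · have : X v * (f * u) = ∑ w ∈ A \ F, f * X v * X w := by
          rw [← Finset.mul_sum]
          ring
        rw [this]
        exact sum_mem fun w hw ↦ hUW (hmem v hvA w hw)
  obtain ⟨n, hn⟩ := Ideal.exists_pow_le_of_le_radical_of_fg hrad (IsNoetherian.noetherian _)
  have hfin := hk.mul_mem (d := 0) fun r hr ↦ Ideal.mem_colon_span_singleton.1 (hn hr)
  rw [monomial_mul, one_mul, constOn_add, ← two_mul] at hfin
  obtain ⟨g, hg⟩ := (hW _).1 hfin
  rw [mem_monIdeal_adjoinPow_symSet] at hg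
  have hgA := hg A hA hFA
  have hgB := hg B hB hFB
  set z : MvPolynomial V k := monomial (constOn F (2 * t)) 1 with hz
  have hfA : f * ∑ w ∈ Aᶜ, X w ∈ monIdeal k (adjoinPow (degSet Aᶜ 2) F s) := by
    rw [Finset.mul_sum]
    refine sum_mem fun w hw ↦ ?_
    rw [hX', monomial_mem_monIdeal]
    refine Or.inl ?_
    simp only [mem_degSet, Finsupp.add_apply, Finset.sum_add_distrib, sum_single_apply,
      Finset.mem_compl]
    simp [hqA, Finset.mem_compl.1 hw]
    try lia
  have hfB : f * u ∈ monIdeal k (adjoinPow (degSet Bᶜ 2) F s) := by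
    rw [hu, Finset.mul_sum]
    refine sum_mem fun w hw ↦ ?_
    rw [hX', monomial_mem_monIdeal]
    refine Or.inl ?_
    have hwB : w ∉ B := fun h ↦ (Finset.mem_sdiff.1 hw).2 (hAB ▸ Finset.mem_inter.2
      ⟨(Finset.mem_sdiff.1 hw).1, h⟩)
    simp only [mem_degSet, Finsupp.add_apply, Finset.sum_add_distrib, sum_single_apply,
      Finset.mem_compl]
    simp [hpB, hwB]
    try lia
  have h1 : z * f - g ∈ monIdeal k (adjoinPow (degSet Aᶜ 2) F s) := by
    refine regular_sum_adjoinPow hpA hpF _ ?_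
    have : ℓ * (z * f - g) = (z * (f * u) - ℓ * g) + z * (f * ∑ w ∈ Aᶜ, X w) := by
      rw [hsplit]
      ring
    rw [← hℓ, this]
    exact add_mem hgA (Ideal.mul_mem_left _ _ hfA)
  have h2 : g ∈ monIdeal k (adjoinPow (degSet Bᶜ 2) F s) := by
    refine regular_sum_adjoinPow hqB hqF _ ?_
    have : ℓ * g = z * (f * u) - (z * (f * u) - ℓ * g) := by ring
    rw [← hℓ, this]
    exact sub_mem (Ideal.mul_mem_left _ _ hfB) hgB
  set m : V →₀ ℕ := constOn F (2 * t) + (Finsupp.single p 1 + Finsupp.single q 1) with hm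
  have hzf : z * f = monomial m 1 := by simp only [hz, hf, X, monomial_mul, mul_one, hm]
  have hmF : ¬ ∃ v ∈ F, s ≤ m v := by
    rintro ⟨v, hv, h⟩
    have h1 : p ≠ v := fun h ↦ hpF (h ▸ hv)
    have h2 : q ≠ v := fun h ↦ hqF (h ▸ hv)
    simp [hm, constOn_apply, hv, h1, h2] at h
    lia
  have hmA : m ∉ adjoinPow (degSet Aᶜ 2) F s := by
    rw [mem_adjoinPow, not_or]
    refine ⟨?_, hmF⟩
    simp only [hm, mem_degSet, Finsupp.add_apply, Finset.sum_add_distrib, sum_single_apply,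
      sum_constOn_eq_zero fun v hv h ↦ Finset.mem_compl.1 hv (hFA h)]
    simp [hpA, hqA]
  have hmB : m ∉ adjoinPow (degSet Bᶜ 2) F s := by
    rw [mem_adjoinPow, not_or]
    refine ⟨?_, hmF⟩
    simp only [hm, mem_degSet, Finsupp.add_apply, Finset.sum_add_distrib, sum_single_apply,
      sum_constOn_eq_zero fun v hv h ↦ Finset.mem_compl.1 hv (hFB h)]
    simp [hpB, hqB]
  have := h1 m hmA
  rw [coeff_sub, h2 m hmB, hzf, coeff_monomial, if_pos rfl, sub_zero] at this
  exact one_ne_zero this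

end Necessity

section Combinatorics

variable {k : Type} [Field k] {V : Type} [DecidableEq V] [Fintype V] {G : SimpleGraph V}

open HLoc

omit [DecidableEq V] in
lemma exists_maximal_indep (G : SimpleGraph V) (H : Set V) {I : Finset V} (hI : I ∈ indepComplex G)
    (hIH : ∀ v ∈ I, v ∈ H) :
    ∃ F, I ⊆ F ∧ F ∈ indepComplex G ∧ (∀ v ∈ F, v ∈ H) ∧
      ∀ F' ∈ indepComplex G, (∀ v ∈ F', v ∈ H) → F ⊆ F' → F = F' := by
  obtain ⟨F, hIF, hF⟩ := (Set.toFinite {F : Finset V | F ∈ indepComplex G ∧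
    ∀ v ∈ F, v ∈ H}).exists_le_maximal (a := I) ⟨hI, hIH⟩
  exact ⟨F, hIF, hF.prop.1, hF.prop.2, fun F' h1 h2 h3 ↦ hF.eq_of_le ⟨h1, h2⟩ h3⟩

omit [DecidableEq V] in
lemma exists_facet_of_indep (G : SimpleGraph V) {I : Finset V} (hI : I ∈ indepComplex G) :
    ∃ F ∈ facets (indepComplex G), I ⊆ F := by
  obtain ⟨F, h1, h2, -, h3⟩ := exists_maximal_indep G Set.univ hI fun _ _ ↦ trivial
  exact ⟨F, ⟨h2, fun F' h h' ↦ h3 F' h (fun _ _ ↦ trivial) h'⟩, h1⟩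

/-- The facets through a maximal independent set of the localization at an edge `pq` that contain
an endpoint of the edge. -/
lemma facet_of_edge {p q : V} (hpq : G.Adj p q)
    (hq : ∀ v w, G.Adj v q → G.Adj w q → ¬ G.Adj v w) {F : Finset V} (hF : F ∈ indepComplex G)
    (hFH : ∀ v ∈ F, ¬ G.Adj v p ∧ ¬ G.Adj v q)
    (hmax : ∀ v, ¬ G.Adj v p → ¬ G.Adj v q → (∀ x ∈ F, ¬ G.Adj v x) → v ∈ F) :
    ∃ A ∈ facets (indepComplex G), F ⊆ A ∧ p ∈ A ∧
      (∀ v, v ∈ A ↔ v ∈ F ∨ (G.Adj v q ∧ ∀ x ∈ F, ¬ G.Adj v x)) ∧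
      ∀ T ∈ facets (indepComplex G), F ⊆ T → p ∈ T → T = A := by
  classical
  let A : Finset V := Finset.univ.filter fun v ↦ v ∈ F ∨ (G.Adj v q ∧ ∀ x ∈ F, ¬ G.Adj v x)
  have hA : ∀ v, v ∈ A ↔ v ∈ F ∨ (G.Adj v q ∧ ∀ x ∈ F, ¬ G.Adj v x) := by simp [A]
  have hFA : F ⊆ A := fun v hv ↦ (hA v).2 (Or.inl hv)
  have hpA : p ∈ A := (hA p).2 (Or.inr ⟨hpq, fun x hx h ↦ (hFH x hx).1 h.symm⟩)
  have hAind : A ∈ indepComplex G := by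
    intro v hv w hw hvw
    rcases (hA v).1 hv with hv | hv <;> rcases (hA w).1 hw with hw | hw
    · exact hF v hv w hw hvw
    · exact hw.2 v hv hvw.symm
    · exact hv.2 w hw hvw
    · exact hq v w hv.1 hw.1 hvw
  have hTA : ∀ T ∈ indepComplex G, F ⊆ T → p ∈ T → T ⊆ A := by
    intro T hT hFT hpT v hv
    have hvF : ∀ x ∈ F, ¬ G.Adj v x := fun x hx ↦ hT v hv x (hFT hx)
    rw [hA]
    by_cases hvq : G.Adj v q
    · exact Or.inr ⟨hvq, hvF⟩
    · exact Or.inl (hmax v (hT v hv p hpT) hvq hvF)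
  refine ⟨A, ⟨hAind, fun T hT hAT ↦ hAT.antisymm (hTA T hT (hFA.trans hAT) (hAT hpA))⟩, hFA, hpA,
    hA, fun T hT hFT hpT ↦ hT.2 A hAind (hTA T hT.1 hFT hpT)⟩

/-- If the facets through `p` over the localization at the edge `pq` have at least two additional
vertices, then the localization is empty. -/
lemma adj_or_adj_of_finitary {p q : V} (hpq : G.Adj p q)
    (hp : ∀ v w, G.Adj v p → G.Adj w p → ¬ G.Adj v w)
    (hq : ∀ v w, G.Adj v q → G.Adj w q → ¬ G.Adj v w) {D : ℕ}
    (hD : ∀ A ∈ facets (indepComplex G), A.card ≤ D) {p' : V} (hpp' : p ≠ p') (hp'q : G.Adj p' q)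
    (hp' : ∀ v, G.Adj v p' → G.Adj v p)
    (h : Finitary (maxIdeal k V) (MvPolynomial V k ⧸ monIdeal k (symSet (indepComplex G) ∅)) D)
    (v : V) : G.Adj v p ∨ G.Adj v q := by
  by_contra! hv
  obtain ⟨F, hvF, hF, hFH, hmax⟩ := exists_maximal_indep G {v | ¬ G.Adj v p ∧ ¬ G.Adj v q}
    (I := {v}) (by simp [indepComplex]) (by simpa using hv)
  rw [Finset.singleton_subset_iff] at hvF
  have hmax' : ∀ v, ¬ G.Adj v p → ¬ G.Adj v q → (∀ x ∈ F, ¬ G.Adj v x) → v ∈ F := by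
    intro v h1 h2 h3
    rw [hmax (insert v F) ?_ ?_ (Finset.subset_insert v F)]
    · exact Finset.mem_insert_self v F
    · intro x hx y hy
      rw [Finset.mem_insert] at hx hy
      rcases hx with rfl | hx <;> rcases hy with rfl | hy
      · exact G.loopless.irrefl _
      · exact h3 y hy
      · exact fun h ↦ h3 x hx h.symm
      · exact hF x hx y hy
    · intro x hx
      rcases Finset.mem_insert.1 hx with rfl | hx
      · exact ⟨h1, h2⟩
      · exact hFH x hx
  obtain ⟨A, hA, hFA, hpA, hmemA, hTA⟩ := facet_of_edge hpq hq hF hFH hmax'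
  obtain ⟨B, hB, hFB, hqB, hmemB, hTB⟩ := facet_of_edge hpq.symm hp hF
    (fun v hv ↦ ⟨(hFH v hv).2, (hFH v hv).1⟩) fun v h1 h2 ↦ hmax' v h2 h1
  have hpF : p ∉ F := fun h ↦ (hFH p h).2 hpq
  have hp'F : p' ∉ F := fun h ↦ (hFH p' h).2 hp'q
  have hp'A : p' ∈ A := (hmemA p').2
    (Or.inr ⟨hp'q, fun x hx h ↦ (hFH x hx).1 (hp' x h.symm)⟩)
  refine not_finitary_of_facets ⟨v, hvF⟩ hA hB ?_ hpA (fun h ↦ hB.1 p h q hqB hpq) hqB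
    (fun h ↦ hA.1 p hpA q h hpq) (fun T hT hFT ↦ ?_) (le_trans ?_ (hD A hA)) h
  · ext v
    rw [Finset.mem_inter, hmemA, hmemB]
    constructor
    · rintro ⟨h | h, h' | h'⟩
      · exact h
      · exact h
      · exact h'
      · exact absurd h'.1 (hq v p h.1 hpq)
    · exact fun h ↦ ⟨Or.inl h, Or.inl h⟩
  · by_cases h1 : p ∈ T
    · exact Or.inl (hTA T hT hFT h1)
    · by_cases h2 : q ∈ T
      · exact Or.inr (Or.inl (hTB T hT hFT h2))
      · exact Or.inr (Or.inr ⟨h1, h2⟩)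
  · have hsub : insert p (insert p' F) ⊆ A := by
      simp only [Finset.insert_subset_iff]
      exact ⟨hpA, hp'A, hFA⟩
    have := Finset.card_le_card hsub
    rwa [Finset.card_insert_of_notMem (by simp [hpp', hpF]),
      Finset.card_insert_of_notMem hp'F] at this

/-- An unmixed bipartite graph without isolated vertices has a perfect matching. -/
lemma exists_matching (hiso : noIsolated G) {P : Finset V}
    (hP : ∀ v w, G.Adj v w → (v ∈ P ↔ w ∉ P)) {m : ℕ}
    (hm : ∀ F ∈ facets (indepComplex G), F.card = m) :
    P.card = m ∧ Pᶜ.card = m ∧ ∃ f : V → V, Set.InjOn f P ∧ ∀ v ∈ P, G.Adj v (f v) := by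
  have hPfac : P ∈ facets (indepComplex G) := by
    refine ⟨fun v hv w hw h ↦ (hP v w h).1 hv hw, fun T hT hPT ↦ hPT.antisymm fun v hv ↦ ?_⟩
    obtain ⟨w, hw⟩ := hiso v
    by_contra hvP
    exact hT v hv w (hPT (by_contra fun h ↦ hvP ((hP v w hw).2 h))) hw
  have hPfac' : Pᶜ ∈ facets (indepComplex G) := by
    refine ⟨fun v hv w hw h ↦ ?_, fun T hT hPT ↦ hPT.antisymm fun v hv ↦ ?_⟩
    · rw [Finset.mem_compl] at hv hw
      exact hv ((hP v w h).2 hw)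
    · obtain ⟨w, hw⟩ := hiso v
      rw [Finset.mem_compl]
      intro hvP
      exact hT v hv w (hPT (Finset.mem_compl.2 ((hP v w hw).1 hvP))) hw
  refine ⟨hm P hPfac, hm _ hPfac', ?_⟩
  classical
  have hall := (Finset.all_card_le_biUnion_card_iff_exists_injective
    fun v : P ↦ Finset.univ.filter (G.Adj v.1)).1 fun S ↦ ?_
  · obtain ⟨f, hf, hfadj⟩ := hall
    refine ⟨fun v ↦ if hv : v ∈ P then f ⟨v, hv⟩ else v, fun v hv w hw h ↦ ?_, fun v hv ↦ ?_⟩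
    · rw [Finset.mem_coe] at hv hw
      simp only [hv, hw, dif_pos] at h
      simpa using hf h
    · simpa [hv] using hfadj ⟨v, hv⟩
  · set N := S.biUnion fun v ↦ Finset.univ.filter (G.Adj v.1) with hN
    have hmemN : ∀ w, w ∈ N ↔ ∃ v ∈ S, G.Adj v.1 w := by simp [hN]
    have hSP : ∀ v ∈ S.map (Function.Embedding.subtype _), v ∈ P := by
      intro v hv
      obtain ⟨x, -, rfl⟩ := Finset.mem_map.1 hv
      exact x.2
    have hind : S.map (Function.Embedding.subtype _) ∪ (Pᶜ \ N) ∈ indepComplex G := by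
      have key : ∀ v ∈ S.map (Function.Embedding.subtype _), ∀ w ∈ Pᶜ \ N, ¬ G.Adj v w := by
        intro v hv w hw h
        obtain ⟨x, hx, rfl⟩ := Finset.mem_map.1 hv
        exact (Finset.mem_sdiff.1 hw).2 ((hmemN w).2 ⟨x, hx, h⟩)
      intro v hv w hw h
      rcases Finset.mem_union.1 hv with hv | hv <;> rcases Finset.mem_union.1 hw with hw | hw
      · exact hPfac.1 v (hSP v hv) w (hSP w hw) h
      · exact key v hv w hw h
      · exact key w hw v hv h.symm
      · exact hPfac'.1 v (Finset.mem_sdiff.1 hv).1 w (Finset.mem_sdiff.1 hw).1 h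
    obtain ⟨T, hT, hsub⟩ := exists_facet_of_indep G hind
    have hcard := Finset.card_le_card hsub
    rw [Finset.card_union_of_disjoint, Finset.card_map, hm T hT, ← hm _ hPfac'] at hcard
    · have := Finset.le_card_sdiff N Pᶜ
      lia
    · rw [Finset.disjoint_left]
      intro v hv hv'
      exact Finset.mem_compl.1 (Finset.mem_sdiff.1 hv').1 (hSP v hv)

/-- In an unmixed bipartite graph, adjacency is transitive along a perfect matching. -/
lemma adj_trans_of_matching {P : Finset V} {f : V → V}
    (hfadj : ∀ v ∈ P, G.Adj v (f v)) (hsurj : ∀ w ∉ P, ∃ v ∈ P, f v = w)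
    (hm : ∀ F ∈ facets (indepComplex G), F.card = P.card) {i j l : V} (hj : j ∈ P)
    (hij : G.Adj i (f j)) (hjl : G.Adj j (f l)) : G.Adj i (f l) := by
  by_contra hil
  have hind : {i, f l} ∈ indepComplex G := by
    intro v hv w hw
    simp only [Finset.mem_insert, Finset.mem_singleton] at hv hw
    rcases hv with rfl | rfl <;> rcases hw with rfl | rfl
    · exact G.loopless.irrefl _
    · exact hil
    · exact fun h ↦ hil h.symm
    · exact G.loopless.irrefl _
  obtain ⟨F, hF, hsub⟩ := exists_facet_of_indep G hind
  have hiF : i ∈ F := hsub (by simp)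
  have hlF : f l ∈ F := hsub (by simp)
  have hFsub : F ⊆ P.filter (· ∈ F) ∪ (P.filter (f · ∈ F)).image f := by
    intro v hv
    simp only [Finset.mem_union, Finset.mem_filter, Finset.mem_image]
    by_cases hvP : v ∈ P
    · exact Or.inl ⟨hvP, hv⟩
    · obtain ⟨w, hw, rfl⟩ := hsurj v hvP
      exact Or.inr ⟨w, ⟨hw, hv⟩, rfl⟩
  have hdisj : Disjoint (P.filter (· ∈ F)) (P.filter (f · ∈ F)) := by
    rw [Finset.disjoint_left]
    intro v hv hv'
    rw [Finset.mem_filter] at hv hv'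
    exact hF.1 v hv.2 _ hv'.2 (hfadj v hv.1)
  have hcard : P.card ≤ (P.filter (· ∈ F) ∪ P.filter (f · ∈ F)).card := by
    rw [Finset.card_union_of_disjoint hdisj, ← hm F hF]
    exact (Finset.card_le_card hFsub).trans ((Finset.card_union_le _ _).trans
      (Nat.add_le_add_left Finset.card_image_le _))
  have hall := Finset.eq_of_subset_of_card_le
    (Finset.union_subset (Finset.filter_subset _ _) (Finset.filter_subset _ _)) hcard
  rw [← hall, Finset.mem_union, Finset.mem_filter, Finset.mem_filter] at hj
  rcases hj with hj | hj
  · exact hF.1 j hj.2 _ hlF hjl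
  · exact hF.1 i hiF _ hj.2 hij

lemma nonempty_iso_completeBipartite {P : Finset V} (hP : ∀ v w, G.Adj v w ↔ (v ∈ P ↔ w ∉ P))
    {m : ℕ} (h1 : P.card = m) (h2 : Pᶜ.card = m) :
    Nonempty (G ≃g completeBipartiteGraph (Fin m) (Fin m)) := by
  let e₁ : {v // v ∈ P} ≃ Fin m := Fintype.equivFinOfCardEq (by simpa using h1)
  let e₂ : {v // v ∉ P} ≃ Fin m := Fintype.equivFinOfCardEq (by
    rw [← h2, Fintype.card_subtype_compl, Fintype.card_coe, Finset.card_compl])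
  let e : V ≃ Fin m ⊕ Fin m := (Equiv.sumCompl (· ∈ P)).symm.trans (Equiv.sumCongr e₁ e₂)
  have hl : ∀ v, (e v).isLeft = true ↔ v ∈ P := by
    intro v
    by_cases hv : v ∈ P <;> simp [e, hv]
  have hr : ∀ v, (e v).isRight = true ↔ v ∉ P := by
    intro v
    by_cases hv : v ∈ P <;> simp [e, hv]
  refine ⟨⟨e, fun {v w} ↦ ?_⟩⟩
  rw [hP, completeBipartiteGraph_adj, hl, hl, hr, hr]
  tauto

omit [DecidableEq V] [Fintype V] in
lemma nonempty_iso_path {a b c d : V} (hab : a ≠ b) (hac : a ≠ c) (had : a ≠ d) (hbc : b ≠ c)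
    (hbd : b ≠ d) (hcd : c ≠ d) (hall : ∀ v, v = a ∨ v = b ∨ v = c ∨ v = d)
    (h1 : G.Adj a b) (h2 : G.Adj b c) (h3 : G.Adj c d) (h4 : ¬ G.Adj a c) (h5 : ¬ G.Adj a d)
    (h6 : ¬ G.Adj b d) : Nonempty (G ≃g SimpleGraph.pathGraph 4) := by
  have hbij : Function.Bijective ![a, b, c, d] := by
    constructor
    · intro i j h
      fin_cases i <;> fin_cases j <;> simp_all
    · intro v
      rcases hall v with rfl | rfl | rfl | rfl
      · exact ⟨0, rfl⟩
      · exact ⟨1, rfl⟩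
      · exact ⟨2, rfl⟩
      · exact ⟨3, rfl⟩
  refine ⟨(RelIso.symm ⟨Equiv.ofBijective _ hbij, fun {i j} ↦ ?_⟩ : G ≃g _)⟩
  rw [SimpleGraph.pathGraph_adj]
  fin_cases i <;> fin_cases j <;> simp [h1, h2, h3, h4, h5, h6, h1.symm, h2.symm, h3.symm,
    G.adj_comm c a, G.adj_comm d a, G.adj_comm d b]

end Combinatorics

section Classification

variable {k : Type} [Field k] {V : Type} [DecidableEq V] [Fintype V] {G : SimpleGraph V}

open HLoc

/-- Generalized Cohen–Macaulayness of the second symbolic power implies that all facets have the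
same cardinality. -/
lemma quotGCM.exists_finitary [Nonempty V]
    (h : quotGCM k V (symbolicPower k (indepComplex G) 2)) :
    ∃ m, (∀ F ∈ facets (indepComplex G), F.card = m) ∧ Finitary (maxIdeal k V)
      (MvPolynomial V k ⧸ monIdeal k (symSet (indepComplex G) ∅)) m := by
  have hfin : ∀ F ∈ facets (indepComplex G), Finitary (maxIdeal k V)
      (MvPolynomial V k ⧸ monIdeal k (symSet (indepComplex G) ∅)) F.card := by
    intro F hF
    have := h.finitary (le_ringKrullDim_of_le_facePrime k
      (symbolicPower_le_facePrime k hF two_ne_zero))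
    rwa [symbolicPower_eq_monIdeal] at this
  have hne : ∀ F ∈ facets (indepComplex G), F.Nonempty := by
    intro F hF
    rw [Finset.nonempty_iff_ne_empty]
    rintro rfl
    obtain ⟨v⟩ := ‹Nonempty V›
    have := hF.2 {v} (by simp [indepComplex]) (Finset.empty_subset _)
    exact (Finset.singleton_ne_empty v) this.symm
  obtain ⟨F, hF, -⟩ := exists_facet_of_indep G (I := ∅) (by simp [indepComplex])
  exact ⟨F.card, fun T hT ↦ le_antisymm (le_card_of_finitary (hne F hF) hF (hfin T hT))
    (le_card_of_finitary (hne T hT) hT (hfin F hF)), hfin F hF⟩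

/-- The bipartite graphs whose second symbolic power is generalized Cohen–Macaulay. -/
lemma quotGCM.classification (hbip : G.Colorable 2) (hiso : noIsolated G)
    (h : quotGCM k V (symbolicPower k (indepComplex G) 2)) :
    (∃ m : ℕ, 2 ≤ m ∧ Nonempty (G ≃g completeBipartiteGraph (Fin m) (Fin m))) ∨
      Nonempty (G ≃g SimpleGraph.pathGraph 4) ∨ ∀ v, ∃! w, G.Adj v w := by
  rcases isEmpty_or_nonempty V with hV | hV
  · exact Or.inr (Or.inr fun v ↦ hV.elim v)
  obtain ⟨m, hm, hfin⟩ := h.exists_finitary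
  obtain ⟨c⟩ := hbip
  let P : Finset V := Finset.univ.filter fun v ↦ c v = 0
  have hP : ∀ v w, G.Adj v w → (v ∈ P ↔ w ∉ P) := by
    intro v w hvw
    have := c.valid hvw
    simp only [P, Finset.mem_filter, Finset.mem_univ, true_and]
    generalize c v = x at *
    generalize c w = y at *
    fin_cases x <;> fin_cases y <;> simp_all
  obtain ⟨hPm, hPm', f, hfinj, hfadj⟩ := exists_matching hiso hP hm
  have hfP : ∀ v ∈ P, f v ∉ P := fun v hv ↦ (hP v _ (hfadj v hv)).1 hv
  have hsurj : ∀ w ∉ P, ∃ v ∈ P, f v = w := by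
    have himg : P.image f = Pᶜ := Finset.eq_of_subset_of_card_le
      (fun w hw ↦ by
        obtain ⟨v, hv, rfl⟩ := Finset.mem_image.1 hw
        exact Finset.mem_compl.2 (hfP v hv))
      (by rw [Finset.card_image_of_injOn hfinj, hPm, hPm'])
    intro w hw
    exact Finset.mem_image.1 (himg ▸ Finset.mem_compl.2 hw)
  have htrans : ∀ {i j l}, j ∈ P → G.Adj i (f j) → G.Adj j (f l) → G.Adj i (f l) :=
    fun hj ↦ adj_trans_of_matching hfadj hsurj (by rwa [hPm]) hj
  have hind : ∀ u v w, G.Adj v u → G.Adj w u → ¬ G.Adj v w := by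
    intro u v w h1 h2 h3
    have := hP v u h1
    have := hP w u h2
    have := hP v w h3
    tauto
  have hstar : ∀ j ∈ P, ∀ l ∈ P, j ≠ l → G.Adj j (f l) →
      (∀ i ∈ P, G.Adj i (f l)) ∧ ∀ i ∈ P, G.Adj j (f i) := by
    intro j hj l hl hjl hadj
    have key := adj_or_adj_of_finitary hadj (hind j) (hind (f l)) (fun A hA ↦ (hm A hA).le) hjl
      (hfadj l hl) (fun v hv ↦ by
        obtain ⟨x, hx, rfl⟩ := hsurj v ((hP l v hv.symm).1 hl)
        exact (htrans hl hadj hv.symm).symm) hfin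
    refine ⟨fun i hi ↦ (key i).resolve_left fun h ↦ ?_, fun i hi ↦
      ((key (f i)).resolve_right fun h ↦ ?_).symm⟩
    · exact (hP i j h).1 hi hj
    · exact hfP i hi ((hP _ _ h).2 (hfP l hl))
  by_cases hex : ∃ j ∈ P, ∃ l ∈ P, j ≠ l ∧ G.Adj j (f l)
  swap
  · push Not at hex
    refine Or.inr (Or.inr fun v ↦ ?_)
    by_cases hv : v ∈ P
    · refine ⟨f v, hfadj v hv, fun w hw ↦ ?_⟩
      obtain ⟨x, hx, rfl⟩ := hsurj w ((hP v w hw).1 hv)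
      rw [not_imp_not.1 (hex v hv x hx) hw]
    · obtain ⟨x, hx, rfl⟩ := hsurj v hv
      refine ⟨x, (hfadj x hx).symm, fun w hw ↦ ?_⟩
      have hwP : w ∈ P := (hP w _ hw.symm).2 hv
      exact not_imp_not.1 (hex w hwP x hx) hw.symm
  obtain ⟨j, hj, l, hl, hjl, hadj⟩ := hex
  by_cases hcomp : ∀ x ∈ P, ∀ y ∈ P, G.Adj x (f y)
  · refine Or.inl ⟨m, ?_,
      nonempty_iso_completeBipartite (fun v w ↦ ⟨hP v w, fun hvw ↦ ?_⟩) hPm hPm'⟩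
    · rw [← hPm]
      exact Finset.one_lt_card.2 ⟨j, hj, l, hl, hjl⟩
    · by_cases hv : v ∈ P
      · obtain ⟨x, hx, rfl⟩ := hsurj w (hvw.1 hv)
        exact hcomp v hv x hx
      · obtain ⟨x, hx, rfl⟩ := hsurj v hv
        exact (hcomp w (by tauto) x hx).symm
  push Not at hcomp
  obtain ⟨x, hx, y, hy, hxy⟩ := hcomp
  obtain ⟨hjl₁, hjl₂⟩ := hstar j hj l hl hjl hadj
  have hxl : x = l := by
    by_contra hne
    exact hxy ((hstar x hx l hl hne (hjl₁ x hx)).2 y hy)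
  subst hxl
  have hPxy : ∀ i ∈ P, i ≠ x → i = y := by
    intro i hi hix
    by_contra hiy
    exact hxy ((hstar i hi y hy hiy ((hstar i hi x hx hix (hjl₁ i hi)).2 y hy)).1 x hx)
  obtain rfl := hPxy j hj hjl
  have hne : ∀ v ∈ P, ∀ w ∈ P, v ≠ f w := fun v hv w hw h ↦ hfP w hw (h ▸ hv)
  refine Or.inr (Or.inl (nonempty_iso_path (a := f j) (b := j) (c := f x) (d := x)
    (hne j hj j hj).symm (fun h ↦ hjl (hfinj hj hx h)) (hne x hx j hj).symm (hne j hj x hx)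
    hjl (hne x hx x hx).symm
    (fun v ↦ ?_) (hfadj j hj).symm hadj (hfadj x hx).symm ?_ (fun h ↦ hxy h.symm) ?_))
  · have hP' : ∀ i ∈ P, i = x ∨ i = j := fun i hi ↦ or_iff_not_imp_left.2 (hPxy i hi)
    by_cases hv : v ∈ P
    · rcases hP' v hv with rfl | rfl <;> simp
    · obtain ⟨i, hi, rfl⟩ := hsurj v hv
      rcases hP' i hi with rfl | rfl <;> simp
  · exact fun h ↦ hfP j hj ((hP _ _ h).2 (hfP x hx))
  · exact fun h ↦ (hP _ _ h).1 hj hx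

lemma quotGCM_of_iso_completeBipartite {m : ℕ} (hm : m ≠ 0)
    (e : G ≃g completeBipartiteGraph (Fin m) (Fin m)) :
    quotGCM k V (symbolicPower k (indepComplex G) 2) := by
  have hl : (Finset.univ.filter fun v ↦ (e v).isLeft = true).card = m := by
    have himg : (Finset.univ.filter fun v ↦ (e v).isLeft = true) =
        Finset.univ.image (e.symm ∘ Sum.inl) := by
      ext v
      obtain ⟨x, rfl⟩ := e.symm.surjective v
      rcases x with x | x <;> simp
    rw [himg, Finset.card_image_of_injective _ (e.symm.injective.comp Sum.inl_injective),
      Finset.card_univ, Fintype.card_fin]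
  have hV : Fintype.card V = m + m := by simpa using Fintype.card_congr e.toEquiv
  refine quotGCM_of_completeBipartite G (Finset.univ.filter fun v ↦ (e v).isLeft = true)
    (fun v w ↦ ?_) ?_ ?_
  · rw [← e.map_adj_iff, completeBipartiteGraph_adj]
    simp only [Finset.mem_filter, Finset.mem_univ, true_and]
    cases e v <;> cases e w <;> simp
  · rw [Finset.card_compl, hl, hV, Nat.add_sub_cancel]
  · rw [← Finset.card_pos, hl]
    exact Nat.pos_of_ne_zero hm

lemma quotGCM_of_iso_path (e : G ≃g SimpleGraph.pathGraph 4) :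
    quotGCM k V (symbolicPower k (indepComplex G) 2) := by
  have hne : ∀ i j, i ≠ j → e.symm i ≠ e.symm j := fun i j ↦ e.symm.injective.ne
  refine quotGCM_of_path G (hne 0 1 (by decide)) (hne 0 2 (by decide)) (hne 0 3 (by decide))
    (hne 1 2 (by decide)) (hne 1 3 (by decide)) (hne 2 3 (by decide)) ?_ fun v w ↦ ?_
  · ext v
    obtain ⟨i, rfl⟩ := e.symm.surjective v
    fin_cases i <;> simp
  · obtain ⟨i, rfl⟩ := e.symm.surjective v
    obtain ⟨j, rfl⟩ := e.symm.surjective w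
    rw [e.symm.map_adj_iff, SimpleGraph.pathGraph_adj]
    simp only [e.symm.injective.eq_iff]
    revert i j
    decide

end Classification

end

/-- **Proposition 4.4.** For a bipartite graph `G` (without isolated vertices),
`S/I(G)^{(2)}` is generalized Cohen–Macaulay if and only if `G` is a complete bipartite
graph `K_{m,m}` with `m ≥ 2`, a path of length 3 (a path on 4 vertices), or a disjoint
union of edges. -/
theorem bipartite_second_symbolic_power_gCM_iff {n : ℕ} (k : Type) [Field k]
    (G : SimpleGraph (Fin n)) (hbip : G.Colorable 2) (hiso : noIsolated G) :
    quotGCM k (Fin n) (symbolicPower k (indepComplex G) 2) ↔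
      ((∃ m : ℕ, 2 ≤ m ∧
          Nonempty (G ≃g completeBipartiteGraph (Fin m) (Fin m))) ∨
        Nonempty (G ≃g SimpleGraph.pathGraph 4) ∨
        ∀ v : Fin n, ∃! w : Fin n, G.Adj v w) := by
  refine ⟨fun h ↦ h.classification hbip hiso, ?_⟩
  rintro (⟨m, hm, ⟨e⟩⟩ | ⟨⟨e⟩⟩ | h)
  · exact quotGCM_of_iso_completeBipartite (by lia) e
  · exact quotGCM_of_iso_path e
  · exact quotGCM_of_disjoint_edges G h
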